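/- Let p ∈ (1,∞), let Ω ⊆ ℝ^d be a domain, and let V ∈ L^∞_loc(Ω) be real-valued. Suppose Q_V is nonnegative in Ω and admits a ground state φ₀. Then there exists a continuous function W : Ω → ℝ with W > 0 everywhere on Ω such that: for every ψ ∈ C_c^∞(Ω) with ∫_Ω ψ φ₀ dx ≠ 0 there exists a constant C > 0 such that the Poincaré-type inequality Q_V(u) + C·|∫_Ω ψ u dx|^p ≥ C^{−1} ∫_Ω W |u|^p dx holds for all u ∈ C_c^∞(Ω). -/

import Mathlib

open MeasureTheory Filter
open scoped Topology RealInnerProductSpace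

noncomputable section

abbrev Ed (d : ℕ) := EuclideanSpace ℝ (Fin d)

/-- A smooth test function compactly supported inside Ω. -/
def IsTestOn {d : ℕ} (Ω : Set (Ed d)) (u : Ed d → ℝ) : Prop :=
  ContDiff ℝ (⊤ : ℕ∞) u ∧ HasCompactSupport u ∧ tsupport u ⊆ Ω

/-- `V ∈ L^∞_loc(Ω)`. -/
def LocBddOn {d : ℕ} (Ω : Set (Ed d)) (V : Ed d → ℝ) : Prop :=
  Measurable V ∧ ∀ K : Set (Ed d), IsCompact K → K ⊆ Ω →
    ∃ M : ℝ, ∀ᵐ x ∂(volume : Measure (Ed d)), x ∈ K → |V x| ≤ M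

/-- The functional `Q_V(u) = ∫_Ω (|∇u|^p + V|u|^p) dx`. -/
def Qp {d : ℕ} (p : ℝ) (Ω : Set (Ed d)) (V : Ed d → ℝ) (u : Ed d → ℝ) : ℝ :=
  ∫ x in Ω, (‖gradient u x‖ ^ p + V x * |u x| ^ p)

/-- `Q_V` is nonnegative in Ω. -/
def NonnegOn {d : ℕ} (p : ℝ) (Ω : Set (Ed d)) (V : Ed d → ℝ) : Prop :=
  ∀ u, IsTestOn Ω u → 0 ≤ Qp p Ω V u

/-- `Q_V` is subcritical (strictly positive) in Ω: there is a continuous function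
`W > 0` on Ω with `Q_V(u) ≥ ∫_Ω W|u|^p` for all test functions `u`. -/
def SubcriticalOn {d : ℕ} (p : ℝ) (Ω : Set (Ed d)) (V : Ed d → ℝ) : Prop :=
  ∃ W : Ed d → ℝ, ContinuousOn W Ω ∧ (∀ x ∈ Ω, 0 < W x) ∧
    ∀ u, IsTestOn Ω u → (∫ x in Ω, W x * |u x| ^ p) ≤ Qp p Ω V u

/-- A null sequence for `Q_V` in Ω. -/
def NullSeqOn {d : ℕ} (p : ℝ) (Ω : Set (Ed d)) (V : Ed d → ℝ)
    (un : ℕ → Ed d → ℝ) : Prop :=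
  (∀ n, IsTestOn Ω (un n)) ∧ (∀ n x, 0 ≤ un n x) ∧
  (∃ B : Set (Ed d), IsOpen B ∧ IsCompact (closure B) ∧ closure B ⊆ Ω ∧
    ∀ n, (∫ x in B, |un n x| ^ p) = 1) ∧
  Tendsto (fun n => Qp p Ω V (un n)) atTop (𝓝 0)

/-- A ground state of `Q_V` in Ω: a positive C¹ function on Ω that is the limit of
a null sequence in `L^p(K)` for every compact `K ⊆ Ω`. -/
def IsGroundStateOn {d : ℕ} (p : ℝ) (Ω : Set (Ed d)) (V : Ed d → ℝ)
    (φ : Ed d → ℝ) : Prop :=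
  ContDiffOn ℝ 1 φ Ω ∧ (∀ x ∈ Ω, 0 < φ x) ∧
  ∃ un, NullSeqOn p Ω V un ∧ ∀ K : Set (Ed d), IsCompact K → K ⊆ Ω →
    Tendsto (fun n => ∫ x in K, |un n x - φ x| ^ p) atTop (𝓝 0)

/-- `Q_V` is critical in Ω. -/
def CriticalOn {d : ℕ} (p : ℝ) (Ω : Set (Ed d)) (V : Ed d → ℝ) : Prop :=
  NonnegOn p Ω V ∧ ∃ φ, IsGroundStateOn p Ω V φ

/-- A positive weak supersolution of `-Δ_p v + V|v|^{p-2}v = 0` in Ω. -/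
def IsSupersolOn {d : ℕ} (p : ℝ) (Ω : Set (Ed d)) (V : Ed d → ℝ)
    (v : Ed d → ℝ) : Prop :=
  ContDiffOn ℝ 1 v Ω ∧ (∀ x ∈ Ω, 0 < v x) ∧
  ∀ φ, IsTestOn Ω φ → (∀ x, 0 ≤ φ x) →
    0 ≤ ∫ x in Ω, (‖gradient v x‖ ^ (p - 2) * ⟪gradient v x, gradient φ x⟫ +
      V x * v x ^ (p - 1) * φ x)

/-- A positive weak solution of `-Δ_p v + V|v|^{p-2}v = 0` in Ω. -/
def IsSolOn {d : ℕ} (p : ℝ) (Ω : Set (Ed d)) (V : Ed d → ℝ)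
    (v : Ed d → ℝ) : Prop :=
  ContDiffOn ℝ 1 v Ω ∧ (∀ x ∈ Ω, 0 < v x) ∧
  ∀ φ, IsTestOn Ω φ →
    (∫ x in Ω, (‖gradient v x‖ ^ (p - 2) * ⟪gradient v x, gradient φ x⟫ +
      V x * v x ^ (p - 1) * φ x)) = 0

section NormPow
variable {F : Type*} [NormedAddCommGroup F]

/-- NP1 -/
lemma np_one {p : ℝ} (hp : 1 < p) {ε : ℝ} (hε : 0 < ε) :
    ∃ C : ℝ, 0 ≤ C ∧ ∀ (F : Type) [NormedAddCommGroup F] (a b : F),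
      ‖a‖ ^ p ≤ (1 + ε) * ‖b‖ ^ p + C * ‖a - b‖ ^ p := by
  -- choose θ
  have h1 : Tendsto (fun θ : ℝ => θ ^ (1 - p)) (𝓝[<] 1) (𝓝 1) := by
    have : ContinuousAt (fun θ : ℝ => θ ^ (1 - p)) 1 :=
      Real.continuousAt_rpow_const _ _ (Or.inl one_ne_zero)
    have h := this.tendsto
    simp only [Real.one_rpow] at h
    exact h.mono_left nhdsWithin_le_nhds
  have h2 : ∀ᶠ θ : ℝ in 𝓝[<] 1, θ ^ (1 - p) < 1 + ε := h1.eventually_lt_const (by linarith)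
  have h3 : ∀ᶠ θ : ℝ in 𝓝[<] 1, 0 < θ ∧ θ < 1 := by
    have := Ioo_mem_nhdsLT (show (0:ℝ) < 1 by norm_num)
    filter_upwards [this] with θ hθ using hθ
  obtain ⟨θ, hθ, h0, h1⟩ := (h2.and h3).exists
  refine ⟨(1 - θ) ^ (1 - p), Real.rpow_nonneg (by linarith) _, ?_⟩
  intro F _ a b
  have hθ' : 0 < 1 - θ := by linarith
  have htri : ‖a‖ ≤ θ * (‖b‖ / θ) + (1 - θ) * (‖a - b‖ / (1 - θ)) := by
    rw [mul_div_cancel₀ _ h0.ne', mul_div_cancel₀ _ hθ'.ne']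
    calc ‖a‖ = ‖b + (a - b)‖ := by congr 1; abel
      _ ≤ _ := norm_add_le _ _
  have hconv := (convexOn_rpow hp.le).2 (x := ‖b‖ / θ) (y := ‖a - b‖ / (1 - θ))
    (Set.mem_Ici.2 (by positivity)) (Set.mem_Ici.2 (by positivity)) h0.le hθ'.le (by ring)
  simp only [smul_eq_mul] at hconv
  have e1 : θ * (‖b‖ / θ) ^ p = θ ^ (1 - p) * ‖b‖ ^ p := by
    rw [Real.div_rpow (norm_nonneg _) h0.le, Real.rpow_sub h0, Real.rpow_one]; ring
  have e2 : (1 - θ) * (‖a - b‖ / (1 - θ)) ^ p = (1 - θ) ^ (1 - p) * ‖a - b‖ ^ p := by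
    rw [Real.div_rpow (norm_nonneg _) hθ'.le, Real.rpow_sub hθ', Real.rpow_one]; ring
  have h5 : θ ^ (1 - p) * ‖b‖ ^ p ≤ (1 + ε) * ‖b‖ ^ p := by gcongr
  calc ‖a‖ ^ p ≤ _ := Real.rpow_le_rpow (norm_nonneg _) htri (by linarith)
    _ ≤ _ := hconv
    _ ≤ _ := by rw [e1, e2]; linarith

lemma np_two {p : ℝ} (hp : 1 < p) {ε : ℝ} (hε : 0 < ε) :
    ∃ C : ℝ, 0 ≤ C ∧ ∀ (F : Type) [NormedAddCommGroup F] (a b : F),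
      |‖a‖ ^ p - ‖b‖ ^ p| ≤ ε * ‖b‖ ^ p + C * ‖a - b‖ ^ p := by
  obtain ⟨C, hC, h⟩ := np_one hp (ε := min 1 (ε / 2)) (by positivity)
  refine ⟨C + ε / 2 * C + C, by positivity, fun F _ a b => ?_⟩
  have h1 := h F a b
  have h2 := h F b a
  rw [norm_sub_rev] at h2
  have hb : 0 ≤ ‖b‖ ^ p := by positivity
  have ha : 0 ≤ ‖a‖ ^ p := by positivity
  have hab : 0 ≤ C * ‖a - b‖ ^ p := by positivity
  set A := ‖a‖ ^ p
  set B := ‖b‖ ^ p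
  set D := C * ‖a - b‖ ^ p
  have i1 : min 1 (ε / 2) * B ≤ ε / 2 * B := by gcongr; exact min_le_right _ _
  have i1' : min 1 (ε / 2) * B ≤ 1 * B := by gcongr; exact min_le_left _ _
  have i2 : min 1 (ε / 2) * A ≤ ε / 2 * A := by gcongr; exact min_le_right _ _
  have i3 : A ≤ 2 * B + D := by linarith
  have i4 : ε / 2 * A ≤ ε / 2 * (2 * B + D) := by gcongr
  have i5 : 0 ≤ ε * B := by positivity
  have i6 : 0 ≤ ε / 2 * D := by positivity
  have e : (C + ε / 2 * C + C) * ‖a - b‖ ^ p = D + ε / 2 * D + D := by ring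
  rw [e, abs_le]
  constructor <;> nlinarith

/-- convex combination -/
lemma np_conv {p : ℝ} (hp : 1 < p) {F : Type} [NormedAddCommGroup F] [NormedSpace ℝ F]
    {η : ℝ} (h0 : 0 ≤ η) (h1 : η ≤ 1) (c a : F) :
    ‖(1 - η) • c + η • a‖ ^ p ≤ (1 - η) * ‖c‖ ^ p + η * ‖a‖ ^ p := by
  have hconv := (convexOn_rpow hp.le).2 (x := ‖c‖) (y := ‖a‖)
    (Set.mem_Ici.2 (by positivity)) (Set.mem_Ici.2 (by positivity)) (sub_nonneg.2 h1) h0 (by ring)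
  simp only [smul_eq_mul] at hconv
  refine le_trans (Real.rpow_le_rpow (norm_nonneg _) ?_ (by linarith)) hconv
  refine (norm_add_le _ _).trans ?_
  rw [norm_smul, norm_smul, Real.norm_of_nonneg h0, Real.norm_of_nonneg (sub_nonneg.2 h1)]

lemma np_add {p : ℝ} (hp : 1 < p) {F : Type} [NormedAddCommGroup F] [NormedSpace ℝ F] (a b : F) :
    ‖a + b‖ ^ p ≤ 2 ^ p * (‖a‖ ^ p + ‖b‖ ^ p) := by
  have h := np_conv hp (η := 1 / 2) (by norm_num) (by norm_num) ((2 : ℝ) • a) ((2 : ℝ) • b)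
  have e : (1 - 1 / 2 : ℝ) • ((2 : ℝ) • a) + (1 / 2 : ℝ) • ((2 : ℝ) • b) = a + b := by
    rw [smul_smul, smul_smul]; norm_num
  rw [e, norm_smul, norm_smul, Real.mul_rpow (by positivity) (by positivity),
    Real.mul_rpow (by positivity) (by positivity), Real.norm_of_nonneg (by norm_num : (0:ℝ) ≤ 2)] at h
  have h1 : 0 ≤ (2:ℝ) ^ p * ‖a‖ ^ p := by positivity
  have h2 : 0 ≤ (2:ℝ) ^ p * ‖b‖ ^ p := by positivity
  linarith
end NormPow

section LL
variable {d : ℕ}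

def NG (p : ℝ) (a : Ed d) : Ed d := (p * ‖a‖ ^ (p - 2)) • a

def LL (p : ℝ) (a b : Ed d) : ℝ := ‖a + b‖ ^ p - ‖a‖ ^ p - ⟪NG p a, b⟫

lemma NG_hasFDerivAt {p : ℝ} (hp : 1 < p) (a : Ed d) :
    HasFDerivAt (fun x : Ed d => ‖x‖ ^ p) (innerSL ℝ (NG p a)) a := by
  have h := hasFDerivAt_norm_rpow a hp
  have e : innerSL ℝ (NG p a) = (p * ‖a‖ ^ (p - 2)) • innerSL ℝ a := by
    ext x
    simp [NG, real_inner_smul_left]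
  rw [e]; exact h

lemma NG_continuous {p : ℝ} (hp : 1 < p) : Continuous (NG p : Ed d → Ed d) := by
  have h1 : Continuous (fderiv ℝ (fun x : Ed d => ‖x‖ ^ p)) :=
    (contDiff_norm_rpow hp).continuous_fderiv one_ne_zero
  have h2 : (NG p : Ed d → Ed d) = fun a => (InnerProductSpace.toDual ℝ (Ed d)).symm
      (fderiv ℝ (fun x : Ed d => ‖x‖ ^ p) a) := by
    funext a
    rw [(NG_hasFDerivAt hp a).fderiv, LinearIsometryEquiv.eq_symm_apply]
    rfl
  rw [h2]
  exact (LinearIsometryEquiv.continuous _).comp h1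

lemma NG_smul {p : ℝ} {t : ℝ} (ht : 0 < t) (a : Ed d) :
    NG p (t • a) = t ^ (p - 1) • NG p a := by
  simp only [NG, norm_smul, Real.norm_of_nonneg ht.le, smul_smul]
  congr 1
  rw [Real.mul_rpow ht.le (norm_nonneg _)]
  have : t ^ (p - 1) = t ^ (p - 2) * t := by
    rw [← Real.rpow_add_one ht.ne']; ring_nf
  rw [this]; ring

lemma LL_continuous {p : ℝ} (hp : 1 < p) :
    Continuous (fun x : Ed d × Ed d => LL p x.1 x.2) := by
  unfold LL
  have := (NG_continuous (d := d) hp).comp (continuous_fst (Y := Ed d))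
  have h1 : Continuous (fun x : Ed d × Ed d => ‖x.1 + x.2‖ ^ p) :=
    (continuous_norm.comp (continuous_fst.add continuous_snd)).rpow_const
      (fun _ => Or.inr (by linarith))
  have h2 : Continuous (fun x : Ed d × Ed d => ‖x.1‖ ^ p) :=
    (continuous_norm.comp continuous_fst).rpow_const (fun _ => Or.inr (by linarith))
  exact (h1.sub h2).sub (this.inner continuous_snd)

lemma LL_smul {p : ℝ} (hp : 1 < p) {t : ℝ} (ht : 0 < t) (a b : Ed d) :
    LL p (t • a) (t • b) = t ^ p * LL p a b := by
  simp only [LL, NG_smul ht, ← smul_add, norm_smul, Real.norm_of_nonneg ht.le,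
    real_inner_smul_left, real_inner_smul_right]
  rw [Real.mul_rpow ht.le (norm_nonneg _), Real.mul_rpow ht.le (norm_nonneg _)]
  have : t ^ p = t ^ (p - 1) * t := by
    rw [← Real.rpow_add_one ht.ne']; ring_nf
  rw [this]; ring

lemma LL_pos {p : ℝ} (hp : 1 < p) (a b : Ed d) (hb : b ≠ 0) : 0 < LL p a b := by
  by_cases ha : a = 0
  · subst ha
    have : 0 < ‖b‖ ^ p := Real.rpow_pos_of_pos (norm_pos_iff.2 hb) _
    simp [LL, NG, Real.zero_rpow (by linarith : p ≠ 0), this]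
  have hs : 0 < ‖a‖ := norm_pos_iff.2 ha
  set s := ‖a‖ with hs_def
  set r := ‖a + b‖ with hr_def
  have hr : 0 ≤ r := norm_nonneg _
  have hL : LL p a b = r ^ p - s ^ p - p * s ^ (p - 2) * (⟪a, a + b⟫ - s ^ 2) := by
    simp only [LL, NG, real_inner_smul_left, inner_add_right, real_inner_self_eq_norm_sq]
    ring
  have hsp : 0 < p * s ^ (p - 2) := by positivity
  have e1 : s ^ p = s ^ (p - 2) * s ^ 2 := by
    rw [← Real.rpow_natCast, ← Real.rpow_add hs]; norm_num
  -- Bernoulli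
  have e2 : r ^ p = s ^ p * (1 + (r / s - 1)) ^ p := by
    rw [add_sub_cancel, Real.div_rpow hr hs.le]; field_simp
  have e3 : s ^ p * (1 + p * (r / s - 1)) = s ^ p + p * s ^ (p - 2) * (s * r - s ^ 2) := by
    rw [e1]; field_simp
  have hspp : 0 < s ^ p := by positivity
  have hCS : ⟪a, a + b⟫ ≤ s * r := real_inner_le_norm _ _
  by_cases hrs : r = s
  · have : ⟪a, a + b⟫ < s * r := by
      rw [hs_def, hr_def, inner_lt_norm_mul_iff_real]
      rw [← hs_def, ← hr_def, hrs]
      intro h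
      have := smul_right_injective _ hs.ne' h
      simp at this
      exact hb this
    rw [hL, hrs]
    rw [hrs] at this
    nlinarith
  · have hB : 1 + p * (r / s - 1) < (1 + (r / s - 1)) ^ p := by
      apply one_add_mul_self_lt_rpow_one_add _ _ hp
      · have : 0 ≤ r / s := by positivity
        linarith
      · intro h
        apply hrs
        field_simp at h
        linarith
    have h3 : s ^ p * (1 + p * (r / s - 1)) < r ^ p := by rw [e2]; gcongr
    rw [e3] at h3
    rw [hL]
    nlinarith

lemma LL_nonneg {p : ℝ} (hp : 1 < p) (a b : Ed d) : 0 ≤ LL p a b := by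
  by_cases hb : b = 0
  · simp [LL, hb]
  · exact (LL_pos hp a b hb).le

lemma LL_bound {p : ℝ} (hp : 1 < p) {ε : ℝ} (hε : 0 < ε) :
    ∃ C : ℝ, 0 ≤ C ∧ ∀ a b : Ed d, ‖b‖ ^ p ≤ ε * ‖a‖ ^ p + C * LL p a b := by
  have hp0 : 0 < p := by linarith
  set S : Set (Ed d × Ed d) := {x | ‖x‖ = 1 ∧ ε * ‖x.1‖ ^ p ≤ ‖x.2‖ ^ p} with hS
  have hSc : IsCompact S := by
    have h1 : S = Metric.sphere 0 1 ∩ {x : Ed d × Ed d | ε * ‖x.1‖ ^ p ≤ ‖x.2‖ ^ p} := by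
      ext x; simp [hS]
    rw [h1]
    refine (isCompact_sphere _ _).inter_right (isClosed_le ?_ ?_)
    · exact continuous_const.mul ((continuous_norm.comp continuous_fst).rpow_const
        (fun _ => Or.inr hp0.le))
    · exact ((continuous_norm.comp continuous_snd).rpow_const (fun _ => Or.inr hp0.le))
  have hSpos : ∀ x ∈ S, 0 < LL p x.1 x.2 := by
    intro x hx
    apply LL_pos hp
    intro h
    have h2 := hx.2
    rw [h, norm_zero, Real.zero_rpow hp0.ne'] at h2
    have h3 : 0 ≤ ‖x.1‖ ^ p := by positivity
    have h4 : ‖x.1‖ ^ p = 0 := by nlinarith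
    rw [Real.rpow_eq_zero (norm_nonneg _) hp0.ne'] at h4
    have h5 := hx.1
    rw [Prod.norm_def, h, h4] at h5
    simp at h5
  obtain ⟨δ, hδ, hδS⟩ : ∃ δ > 0, ∀ x ∈ S, δ ≤ LL p x.1 x.2 := by
    rcases S.eq_empty_or_nonempty with h | h
    · exact ⟨1, one_pos, by simp [h]⟩
    · obtain ⟨x, hx, hmin⟩ := hSc.exists_isMinOn h (LL_continuous hp).continuousOn
      exact ⟨_, hSpos x hx, fun y hy => hmin hy⟩
  refine ⟨1 / δ, by positivity, fun a b => ?_⟩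
  have hLn := LL_nonneg hp a b
  by_cases hcase : ‖b‖ ^ p ≤ ε * ‖a‖ ^ p
  · have : 0 ≤ 1 / δ * LL p a b := by positivity
    linarith
  push Not at hcase
  have ha0 : 0 ≤ ε * ‖a‖ ^ p := by positivity
  have hx0 : 0 < ‖(a, b)‖ := by
    rw [norm_pos_iff]
    intro h
    rw [Prod.mk_eq_zero] at h
    rw [h.2, norm_zero, Real.zero_rpow hp0.ne'] at hcase
    linarith
  set t := ‖(a, b)‖ with ht
  have hti : 0 < t⁻¹ := inv_pos.2 hx0
  have hmem : (t⁻¹ • a, t⁻¹ • b) ∈ S := by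
    refine ⟨?_, ?_⟩
    · have : (t⁻¹ • a, t⁻¹ • b) = t⁻¹ • (a, b) := rfl
      rw [this, norm_smul, Real.norm_of_nonneg hti.le, ← ht, inv_mul_cancel₀ hx0.ne']
    · simp only [norm_smul, Real.norm_of_nonneg hti.le]
      rw [Real.mul_rpow hti.le (norm_nonneg _), Real.mul_rpow hti.le (norm_nonneg _)]
      have : 0 ≤ t⁻¹ ^ p := by positivity
      nlinarith
  have h1 := hδS _ hmem
  simp only [LL_smul hp hti] at h1
  have h2 : ‖b‖ ^ p ≤ t ^ p := Real.rpow_le_rpow (norm_nonneg _) (le_max_right _ _) hp0.le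
  have h3 : t⁻¹ ^ p * t ^ p = 1 := by
    rw [Real.inv_rpow hx0.le, inv_mul_cancel₀ (by positivity)]
  have h4 : δ * t ^ p ≤ LL p a b := by
    calc δ * t ^ p ≤ (t⁻¹ ^ p * LL p a b) * t ^ p := by gcongr
      _ = (t⁻¹ ^ p * t ^ p) * LL p a b := by ring
      _ = _ := by rw [h3, one_mul]
  have h5 : t ^ p ≤ 1 / δ * LL p a b := by
    rw [div_mul_eq_mul_div, one_mul, le_div_iff₀ hδ]; linarith
  linarith
end LL

section Poincare

lemma jensen_pow {X : Type*} [MeasurableSpace X] {μ : Measure X} [IsFiniteMeasure μ]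
    {p : ℝ} (hp : 1 < p) {f : X → ℝ} (hf : AEStronglyMeasurable f μ) {M : ℝ}
    (hM : ∀ᵐ x ∂μ, |f x| ≤ M) :
    (∫ x, |f x| ∂μ) ^ p ≤ μ.real Set.univ ^ (p - 1) * ∫ x, |f x| ^ p ∂μ := by
  have hpq : p.HolderConjugate (p / (p - 1)) := Real.HolderConjugate.conjExponent hp
  have hp0 : 0 < p := by linarith
  have h := integral_mul_le_Lp_mul_Lq_of_nonneg (μ := μ) hpq (f := fun x => |f x|) (g := fun _ => 1)
    (Eventually.of_forall fun x => abs_nonneg _) (Eventually.of_forall fun x => zero_le_one)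
    (MemLp.of_bound hf.norm M (by simpa using hM)) (memLp_const _)
  simp only [mul_one, Real.one_rpow, integral_const, smul_eq_mul] at h
  have hI : 0 ≤ ∫ x, |f x| ^ p ∂μ := integral_nonneg fun x => by positivity
  have h2 := Real.rpow_le_rpow (integral_nonneg fun x => abs_nonneg _) h hp0.le
  rw [Real.mul_rpow (by positivity) (by positivity), ← Real.rpow_mul hI, ← Real.rpow_mul (by positivity)] at h2
  have e1 : 1 / p * p = 1 := by field_simp
  have e2 : 1 / (p / (p - 1)) * p = p - 1 := by field_simp
  rw [e1, e2, Real.rpow_one] at h2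
  linarith

lemma jensen_compact {X : Type*} [TopologicalSpace X] [MeasurableSpace X] [OpensMeasurableSpace X]
    [T2Space X]
    {μ : Measure X} [IsFiniteMeasureOnCompacts μ] [SecondCountableTopology X]
    {p : ℝ} (hp : 1 < p) {K : Set X} (hK : IsCompact K) {f : X → ℝ} (hf : ContinuousOn f K) :
    (∫ x in K, |f x| ∂μ) ^ p ≤ μ.real K ^ (p - 1) * ∫ x in K, |f x| ^ p ∂μ := by
  have : IsFiniteMeasure (μ.restrict K) := ⟨by simpa using hK.measure_lt_top⟩
  obtain ⟨M, hM⟩ := hK.exists_bound_of_continuousOn hf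
  have := jensen_pow (μ := μ.restrict K) hp (f := f) (M := M)
    (hf.aestronglyMeasurable hK.measurableSet)
    ((ae_restrict_mem hK.measurableSet).mono fun x hx => by simpa using hM x hx)
  simpa using this

variable {d : ℕ}

lemma cont_gradient {w : Ed d → ℝ} (hw : ContDiff ℝ 1 w) : Continuous (gradient w) :=
  (LinearIsometryEquiv.continuous _).comp (hw.continuous_fderiv one_ne_zero)

lemma cont_normgrad {w : Ed d → ℝ} (hw : ContDiff ℝ 1 w) {p : ℝ} (hp : 1 < p) :
    Continuous (fun x => ‖gradient w x‖ ^ p) :=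
  (cont_gradient hw).norm.rpow_const (fun _ => Or.inr (by linarith))

lemma fderiv_eq_inner {w : Ed d → ℝ} (x v : Ed d) : fderiv ℝ w x v = ⟪gradient w x, v⟫ := by
  rw [← toDual_gradient]; simp

lemma segment_bound {p : ℝ} (hp : 1 < p) {w : Ed d → ℝ} (hw : ContDiff ℝ 1 w)
    (x y : Ed d) {R : ℝ} (hR : ‖x - y‖ ≤ R) :
    |w x - w y| ^ p ≤ R ^ p * ∫ t in Set.Icc (0:ℝ) 1, ‖gradient w (y + t • (x - y))‖ ^ p := by
  have hp0 : 0 < p := by linarith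
  have hR0 : 0 ≤ R := (norm_nonneg _).trans hR
  have hline : Continuous (fun t : ℝ => y + t • (x - y)) := by fun_prop
  have hc : Continuous (fun t : ℝ => ⟪gradient w (y + t • (x - y)), x - y⟫) :=
    ((cont_gradient hw).comp hline).inner continuous_const
  have hd : ∀ t : ℝ, HasDerivAt (fun t : ℝ => w (y + t • (x - y)))
      ⟪gradient w (y + t • (x - y)), x - y⟫ t := by
    intro t
    have h1 : HasDerivAt (fun t : ℝ => y + t • (x - y)) (x - y) t := by
      simpa using ((hasDerivAt_id t).smul_const (x - y)).const_add y
    have h2 := (hw.differentiable one_ne_zero (y + t • (x - y))).hasFDerivAt.comp_hasDerivAt t h1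
    rw [fderiv_eq_inner] at h2
    exact h2
  have hftc := intervalIntegral.integral_eq_sub_of_hasDerivAt (a := 0) (b := 1)
    (fun t _ => hd t) (hc.intervalIntegrable _ _)
  simp only [one_smul, zero_smul, add_zero, add_sub_cancel] at hftc
  rw [intervalIntegral.integral_of_le zero_le_one, ← integral_Icc_eq_integral_Ioc] at hftc
  have hcn : Continuous (fun t : ℝ => ‖gradient w (y + t • (x - y))‖) :=
    ((cont_gradient hw).comp hline).norm
  have h1 : |w x - w y| ≤ R * ∫ t in Set.Icc (0:ℝ) 1, |‖gradient w (y + t • (x - y))‖| := by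
    rw [← hftc, ← integral_const_mul]
    refine (abs_integral_le_integral_abs).trans ?_
    refine integral_mono_of_nonneg (Eventually.of_forall fun t => abs_nonneg _) ?_
      (Eventually.of_forall fun t => ?_)
    · exact (continuous_const.mul hcn.abs).continuousOn.integrableOn_compact isCompact_Icc
    · simp only [abs_norm]
      refine (abs_real_inner_le_norm _ _).trans ?_
      rw [mul_comm]; gcongr
  have h2 := jensen_compact (μ := volume) hp (isCompact_Icc (a := (0:ℝ)) (b := 1))
    hcn.continuousOn
  simp at h2
  calc |w x - w y| ^ p ≤ _ := Real.rpow_le_rpow (abs_nonneg _) h1 hp0.le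
    _ = R ^ p * (∫ t in Set.Icc (0:ℝ) 1, |‖gradient w (y + t • (x - y))‖|) ^ p := by
      rw [Real.mul_rpow hR0 (integral_nonneg fun t => abs_nonneg _)]
    _ ≤ _ := by
      simp only [abs_norm]
      gcongr

lemma half_change {D : Set (Ed d)} (hD : MeasurableSet D) (hconv : Convex ℝ D)
    {G : Ed d → ENNReal} (hG : Measurable G) {y : Ed d} (hy : y ∈ D) {t : ℝ}
    (ht : 1 / 2 ≤ t) (ht1 : t ≤ 1) :
    ∫⁻ x in D, G (y + t • (x - y)) ≤ 2 ^ d * ∫⁻ x in D, G x := by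
  have ht0 : 0 < t := by linarith
  have hGm : Measurable (D.indicator G) := hG.indicator hD
  calc ∫⁻ x in D, G (y + t • (x - y))
      ≤ ∫⁻ x in D, D.indicator G (y + t • (x - y)) := by
        refine setLIntegral_mono' hD fun x hx => ?_
        rw [Set.indicator_of_mem]
        exact hconv.add_smul_sub_mem hy hx ⟨ht0.le, ht1⟩
    _ ≤ ∫⁻ x, D.indicator G (y + t • (x - y)) := setLIntegral_le_lintegral _ _
    _ = ∫⁻ x, D.indicator G (y + t • x) := by
        exact lintegral_sub_right_eq_self (fun x => D.indicator G (y + t • x)) y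
    _ = ∫⁻ x, D.indicator G (y + x) ∂(Measure.map (t • ·) volume) := by
        rw [lintegral_map (by fun_prop) (by fun_prop)]
    _ = ENNReal.ofReal (abs (t ^ d)⁻¹) * ∫⁻ x, D.indicator G (y + x) := by
        rw [Measure.map_addHaar_smul _ ht0.ne', lintegral_smul_measure]
        simp
    _ = ENNReal.ofReal (abs (t ^ d)⁻¹) * ∫⁻ x, D.indicator G x := by
        rw [lintegral_add_left_eq_self (fun x => D.indicator G x) y]
    _ = ENNReal.ofReal (abs (t ^ d)⁻¹) * ∫⁻ x in D, G x := by rw [lintegral_indicator hD]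
    _ ≤ _ := by
        gcongr
        rw [show (2:ENNReal) ^ d = ENNReal.ofReal (2 ^ d) by
          rw [ENNReal.ofReal_pow (by norm_num)]; norm_num]
        apply ENNReal.ofReal_le_ofReal
        rw [abs_of_nonneg (by positivity), ← inv_pow]
        gcongr
        rw [inv_le_comm₀ ht0 (by norm_num)]; linarith

lemma double_change {D : Set (Ed d)} (hD : MeasurableSet D) (hconv : Convex ℝ D)
    {G : Ed d → ENNReal} (hG : Measurable G) {t : ℝ} (ht0 : 0 ≤ t) (ht1 : t ≤ 1) :
    ∫⁻ y in D, ∫⁻ x in D, G (y + t • (x - y)) ≤ 2 ^ d * (∫⁻ x in D, G x) * volume D := by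
  rcases le_total (1 / 2) t with ht | ht
  · calc _ ≤ ∫⁻ y in D, 2 ^ d * ∫⁻ x in D, G x :=
        setLIntegral_mono' hD fun y hy => half_change hD hconv hG hy ht ht1
      _ = _ := by simp
  · rw [lintegral_lintegral_swap (by fun_prop)]
    calc _ = ∫⁻ x in D, ∫⁻ y in D, G (x + (1 - t) • (y - x)) := by
          congr 1; ext x; congr 1; ext y; congr 1; module
      _ ≤ ∫⁻ y in D, 2 ^ d * ∫⁻ x in D, G x :=
        setLIntegral_mono' hD fun y hy => half_change hD hconv hG hy (by linarith) (by linarith)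
      _ = _ := by simp

/-- Poincaré sets -/
def Poin (p : ℝ) (D : Set (Ed d)) : Prop :=
  ∃ C : ℝ, 0 ≤ C ∧ ∀ w : Ed d → ℝ, ContDiff ℝ 1 w → ∃ k : ℝ,
    ∫ x in D, |w x - k| ^ p ≤ C * ∫ x in D, ‖gradient w x‖ ^ p

lemma poin_convex {p : ℝ} (hp : 1 < p) {D : Set (Ed d)} (hD : IsCompact D) (hconv : Convex ℝ D)
    (hpos : volume D ≠ 0) : Poin p D := by
  have hp0 : 0 < p := by linarith
  obtain ⟨R, hR⟩ := hD.isBounded.exists_norm_le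
  have hR' : ∀ x ∈ D, ∀ y ∈ D, ‖x - y‖ ≤ 2 * R := fun x hx y hy => by
    have := norm_sub_le x y; have := hR x hx; have := hR y hy; linarith
  have hR0 : 0 ≤ R := by
    obtain ⟨x, hx⟩ := nonempty_of_measure_ne_zero hpos
    exact (norm_nonneg _).trans (hR x hx)
  have hDm := hD.measurableSet
  refine ⟨(2 * R) ^ p * 2 ^ d, by positivity, fun w hw => ?_⟩
  set G : Ed d → ENNReal := fun x => ENNReal.ofReal (‖gradient w x‖ ^ p) with hGdef
  have hG : Measurable G := (cont_normgrad hw hp).measurable.ennreal_ofReal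
  set f : Ed d → Ed d → ENNReal := fun y x => ENNReal.ofReal (|w x - w y| ^ p) with hf
  have hfm : Measurable (Function.uncurry f) := by
    apply Measurable.ennreal_ofReal
    have : Continuous (fun z : Ed d × Ed d => |w z.2 - w z.1| ^ p) :=
      ((hw.continuous.comp continuous_snd).sub (hw.continuous.comp continuous_fst)).abs.rpow_const
        (fun _ => Or.inr hp0.le)
    exact this.measurable
  have h1 : ∀ y ∈ D, ∀ x ∈ D, f y x ≤ ENNReal.ofReal ((2 * R) ^ p) *
      ∫⁻ t in Set.Icc (0:ℝ) 1, G (y + t • (x - y)) := by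
    intro y hy x hx
    have h := segment_bound hp hw x y (hR' x hx y hy)
    have hc : Continuous (fun t : ℝ => ‖gradient w (y + t • (x - y))‖ ^ p) :=
      (cont_normgrad hw hp).comp (by fun_prop)
    refine (ENNReal.ofReal_le_ofReal h).trans ?_
    rw [ENNReal.ofReal_mul (by positivity), ofReal_integral_eq_lintegral_ofReal
      (hc.continuousOn.integrableOn_compact isCompact_Icc)
      (Eventually.of_forall fun t => by positivity)]
  have h2 : ∫⁻ y in D, ∫⁻ x in D, f y x ≤
      ENNReal.ofReal ((2 * R) ^ p) * (2 ^ d * (∫⁻ x in D, G x) * volume D) := by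
    calc _ ≤ ∫⁻ y in D, ∫⁻ x in D, ENNReal.ofReal ((2 * R) ^ p) *
          ∫⁻ t in Set.Icc (0:ℝ) 1, G (y + t • (x - y)) :=
          setLIntegral_mono' hDm fun y hy => setLIntegral_mono' hDm fun x hx => h1 y hy x hx
      _ = ENNReal.ofReal ((2 * R) ^ p) * ∫⁻ y in D, ∫⁻ x in D,
          ∫⁻ t in Set.Icc (0:ℝ) 1, G (y + t • (x - y)) := by
          rw [← lintegral_const_mul' _ _ ENNReal.ofReal_ne_top]
          congr 1; ext y
          rw [← lintegral_const_mul' _ _ ENNReal.ofReal_ne_top]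
      _ = ENNReal.ofReal ((2 * R) ^ p) * ∫⁻ t in Set.Icc (0:ℝ) 1, ∫⁻ y in D, ∫⁻ x in D,
           G (y + t • (x - y)) := by
          have e1 : ∀ y : Ed d, ∫⁻ x in D, ∫⁻ t in Set.Icc (0:ℝ) 1, G (y + t • (x - y)) =
              ∫⁻ t in Set.Icc (0:ℝ) 1, ∫⁻ x in D, G (y + t • (x - y)) := by
            intro y
            apply lintegral_lintegral_swap
            apply Measurable.aemeasurable
            unfold Function.uncurry
            fun_prop
          simp_rw [e1]
          congr 1
          apply lintegral_lintegral_swap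
          apply Measurable.aemeasurable
          unfold Function.uncurry
          apply Measurable.lintegral_prod_right' (f := fun z : (Ed d × ℝ) × Ed d =>
              G (z.1.1 + z.1.2 • (z.2 - z.1.1)))
          fun_prop
      _ ≤ ENNReal.ofReal ((2 * R) ^ p) * ∫⁻ t in Set.Icc (0:ℝ) 1,
            (2 ^ d * (∫⁻ x in D, G x) * volume D) := by
          gcongr 1
          exact setLIntegral_mono' measurableSet_Icc fun t ht =>
            double_change hDm hconv hG ht.1 ht.2
      _ = _ := by simp
  have hfin : volume D ≠ ⊤ := hD.measure_lt_top.ne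
  obtain ⟨y, hy, hle⟩ := exists_le_setLAverage (f := fun y => ∫⁻ x in D, f y x) hpos hfin
    (hfm.lintegral_prod_right').aemeasurable
  refine ⟨w y, ?_⟩
  rw [setLAverage_eq] at hle
  have h3 : ∫⁻ x in D, f y x ≤ ENNReal.ofReal ((2 * R) ^ p) * (2 ^ d * (∫⁻ x in D, G x)) := by
    refine hle.trans ?_
    rw [ENNReal.div_le_iff hpos hfin]
    refine h2.trans (le_of_eq ?_)
    ring
  have hci : IntegrableOn (fun x => ‖gradient w x‖ ^ p) D :=
    (cont_normgrad hw hp).continuousOn.integrableOn_compact hD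
  have hci2 : IntegrableOn (fun x => |w x - w y| ^ p) D := by
    have : Continuous (fun x => |w x - w y| ^ p) :=
      (hw.continuous.sub continuous_const).abs.rpow_const (fun _ => Or.inr hp0.le)
    exact this.continuousOn.integrableOn_compact hD
  simp only [hf, hGdef] at h3
  rw [← ofReal_integral_eq_lintegral_ofReal hci (Eventually.of_forall fun t => by positivity),
    ← ofReal_integral_eq_lintegral_ofReal hci2 (Eventually.of_forall fun t => by positivity),
    show (2:ENNReal) ^ d = ENNReal.ofReal (2 ^ d) by
          rw [ENNReal.ofReal_pow (by norm_num)]; norm_num,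
    ← ENNReal.ofReal_mul (by positivity), ← ENNReal.ofReal_mul (by positivity),
    ENNReal.ofReal_le_ofReal_iff] at h3
  · linarith
  · have := integral_nonneg (μ := volume.restrict D) (f := fun x => ‖gradient w x‖ ^ p)
      (fun x => by positivity)
    positivity
end Poincare

section Poincare2
variable {d : ℕ}

lemma intOn_pow {p : ℝ} (hp : 1 < p) {w : Ed d → ℝ} {S : Set (Ed d)} (hw : ContinuousOn w S) (k : ℝ)
    (hS : IsCompact S) : IntegrableOn (fun x => |w x - k| ^ p) S := by
  have : ContinuousOn (fun x => |w x - k| ^ p) S :=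
    (hw.sub continuousOn_const).abs.rpow_const (fun _ _ => Or.inr (by linarith))
  exact this.integrableOn_compact hS

lemma union_le {f : Ed d → ℝ} (hf : ∀ x, 0 ≤ f x) {S T : Set (Ed d)} (hS : IsCompact S)
    (hT : IsCompact T) (hfS : IntegrableOn f S) (hfT : IntegrableOn f T) :
    ∫ x in S ∪ T, f x ≤ (∫ x in S, f x) + ∫ x in T, f x := by
  rw [← Set.union_sdiff_self, setIntegral_union Set.disjoint_sdiff_right
    (hT.measurableSet.diff hS.measurableSet) hfS (hfT.mono_set Set.sdiff_subset)]
  have hs : T \ S ⊆ T := Set.sdiff_subset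
  exact add_le_add le_rfl (setIntegral_mono_set hfT (Eventually.of_forall hf) hs.eventuallyLE)

lemma mono_int {f : Ed d → ℝ} (hf : ∀ x, 0 ≤ f x) {S T : Set (Ed d)} (hST : S ⊆ T)
    (hfT : IntegrableOn f T) : ∫ x in S, f x ≤ ∫ x in T, f x :=
  setIntegral_mono_set hfT (Eventually.of_forall hf) (Eventually.of_forall hST)

lemma abs_np_add {p : ℝ} (hp : 1 < p) (a b : ℝ) : |a + b| ^ p ≤ 2 ^ p * (|a| ^ p + |b| ^ p) := by
  simpa using np_add hp a b

lemma poin_union {p : ℝ} (hp : 1 < p) {S T : Set (Ed d)} (hS : IsCompact S) (hT : IsCompact T)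
    (hPS : Poin p S) (hPT : Poin p T) (hST : volume (S ∩ T) ≠ 0) : Poin p (S ∪ T) := by
  obtain ⟨C₁, hC₁, h₁⟩ := hPS
  obtain ⟨C₂, hC₂, h₂⟩ := hPT
  have hI : IsCompact (S ∩ T) := hS.inter_right hT.isClosed
  set m := volume.real (S ∩ T) with hm
  have hm0 : 0 < m := ENNReal.toReal_pos hST hI.measure_lt_top.ne
  refine ⟨C₁ + 2 ^ p * (C₂ + 2 ^ p * (C₁ + C₂) / m * volume.real T), by positivity,
    fun w hw => ?_⟩
  obtain ⟨k₁, hk₁⟩ := h₁ w hw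
  obtain ⟨k₂, hk₂⟩ := h₂ w hw
  have hg : ∀ S : Set (Ed d), IsCompact S → IntegrableOn (fun x => ‖gradient w x‖ ^ p) S :=
    fun S hS => (cont_normgrad hw hp).continuousOn.integrableOn_compact hS
  have hg0 : ∀ x, 0 ≤ ‖gradient w x‖ ^ p := fun x => by positivity
  set X := ∫ x in S ∪ T, ‖gradient w x‖ ^ p with hX
  have hX1 : ∫ x in S, ‖gradient w x‖ ^ p ≤ X :=
    mono_int hg0 Set.subset_union_left (hg _ (hS.union hT))
  have hX2 : ∫ x in T, ‖gradient w x‖ ^ p ≤ X :=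
    mono_int hg0 Set.subset_union_right (hg _ (hS.union hT))
  have hw0 : ∀ k x, 0 ≤ |w x - k| ^ p := fun k x => by positivity
  have hwi : ∀ k, ∀ S : Set (Ed d), IsCompact S → IntegrableOn (fun x => |w x - k| ^ p) S :=
    fun k S hS => intOn_pow hp hw.continuous.continuousOn k hS
  have a1 : ∫ x in S, |w x - k₁| ^ p ≤ C₁ * X := hk₁.trans (by gcongr)
  have a2 : ∫ x in T, |w x - k₂| ^ p ≤ C₂ * X := hk₂.trans (by gcongr)
  have a3 : |k₁ - k₂| ^ p * m ≤ 2 ^ p * (C₁ * X + C₂ * X) := by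
    calc |k₁ - k₂| ^ p * m = ∫ x in S ∩ T, |k₁ - k₂| ^ p := by
          simp [hm, mul_comm]
      _ ≤ ∫ x in S ∩ T, 2 ^ p * (|w x - k₂| ^ p + |w x - k₁| ^ p) := by
          refine integral_mono_of_nonneg (Eventually.of_forall fun x => by positivity)
            (((hwi k₂ _ hI).add (hwi k₁ _ hI)).const_mul _) (Eventually.of_forall fun x => ?_)
          have := abs_np_add hp (w x - k₂) (-(w x - k₁))
          rw [abs_neg] at this
          have e : k₁ - k₂ = (w x - k₂) + -(w x - k₁) := by ring
          show |k₁ - k₂| ^ p ≤ _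
          rw [e]; exact this
      _ = 2 ^ p * ((∫ x in S ∩ T, |w x - k₂| ^ p) + ∫ x in S ∩ T, |w x - k₁| ^ p) := by
          rw [integral_const_mul, integral_add (hwi k₂ _ hI) (hwi k₁ _ hI)]
      _ ≤ 2 ^ p * ((∫ x in T, |w x - k₂| ^ p) + ∫ x in S, |w x - k₁| ^ p) := by
          exact mul_le_mul_of_nonneg_left (add_le_add
            (mono_int (hw0 _) Set.inter_subset_right (hwi _ _ hT))
            (mono_int (hw0 _) Set.inter_subset_left (hwi _ _ hS))) (by positivity)
      _ ≤ _ := by rw [add_comm (C₁ * X)]; gcongr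
  have a4 : ∫ x in T, |w x - k₁| ^ p ≤
      2 ^ p * (C₂ * X + |k₁ - k₂| ^ p * volume.real T) := by
    calc _ ≤ ∫ x in T, 2 ^ p * (|w x - k₂| ^ p + |k₁ - k₂| ^ p) := by
          refine integral_mono_of_nonneg (Eventually.of_forall (hw0 _))
            (((hwi k₂ _ hT).add (integrableOn_const hT.measure_lt_top.ne)).const_mul _)
            (Eventually.of_forall fun x => ?_)
          have := abs_np_add hp (w x - k₂) (-(k₁ - k₂))
          rw [abs_neg] at this
          have e : w x - k₁ = (w x - k₂) + -(k₁ - k₂) := by ring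
          show |w x - k₁| ^ p ≤ _
          rw [e]; exact this
      _ = 2 ^ p * ((∫ x in T, |w x - k₂| ^ p) + |k₁ - k₂| ^ p * volume.real T) := by
          rw [integral_const_mul, integral_add (hwi k₂ _ hT) 
            (integrableOn_const hT.measure_lt_top.ne)]
          simp [mul_comm]
      _ ≤ _ := by gcongr
  have a5 : |k₁ - k₂| ^ p ≤ 2 ^ p * (C₁ * X + C₂ * X) / m := by
    rw [le_div_iff₀ hm0]; exact a3
  refine ⟨k₁, ?_⟩
  calc _ ≤ _ := union_le (hw0 k₁) hS hT (hwi _ _ hS) (hwi _ _ hT)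
    _ ≤ C₁ * X + 2 ^ p * (C₂ * X + 2 ^ p * (C₁ * X + C₂ * X) / m * volume.real T) := by
      refine add_le_add a1 (a4.trans ?_)
      gcongr
    _ = _ := by ring

lemma poin_ball {p : ℝ} (hp : 1 < p) (x : Ed d) {r : ℝ} (hr : 0 < r) :
    Poin p (Metric.closedBall x r) :=
  poin_convex hp (isCompact_closedBall _ _) (convex_closedBall _ _)
    (Metric.measure_closedBall_pos _ _ hr).ne'

lemma vol_inter_ne {S T : Set (Ed d)} {x : Ed d} (h1 : x ∈ interior S) (h2 : x ∈ interior T) :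
    volume (S ∩ T) ≠ 0 := by
  refine (Measure.measure_pos_of_nonempty_interior _ ⟨x, ?_⟩).ne'
  rw [interior_inter]; exact ⟨h1, h2⟩

lemma poin_exhaust {p : ℝ} (hp : 1 < p) {Ω : Set (Ed d)} (ho : IsOpen Ω) (hc : IsConnected Ω)
    {K : Set (Ed d)} (hK : IsCompact K) (hKΩ : K ⊆ Ω) :
    ∃ D : Set (Ed d), IsCompact D ∧ K ⊆ D ∧ D ⊆ Ω ∧ Poin p D := by
  obtain ⟨x₀, hx₀⟩ := hc.nonempty
  have hball : ∀ x ∈ Ω, ∃ r > 0, Metric.closedBall x r ⊆ Ω := fun x hx =>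
    Metric.nhds_basis_closedBall.mem_iff.1 (ho.mem_nhds hx)
  set P : Set (Ed d) → Prop := fun D => IsCompact D ∧ D ⊆ Ω ∧ Poin p D ∧ x₀ ∈ interior D with hP
  have hPu : ∀ S T, P S → P T → P (S ∪ T) := by
    rintro S T ⟨a, b, c, e⟩ ⟨a', b', c', e'⟩
    exact ⟨a.union a', Set.union_subset b b', poin_union hp a a' c c' (vol_inter_ne e e'),
      interior_mono Set.subset_union_left e⟩
  set U : Set (Ed d) := {x | ∃ D, P D ∧ x ∈ interior D} with hU
  have hUo : IsOpen U := by
    have : U = ⋃ D ∈ {D | P D}, interior D := by ext; simp [hU]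
    rw [this]
    exact isOpen_biUnion fun D _ => isOpen_interior
  have hmem : ∀ (x : Ed d) (r : ℝ), 0 < r → x ∈ interior (Metric.closedBall x r) := fun x r hr =>
    Metric.ball_subset_interior_closedBall (Metric.mem_ball_self hr)
  obtain ⟨r₀, hr₀, hB₀⟩ := hball x₀ hx₀
  have hP₀ : P (Metric.closedBall x₀ r₀) :=
    ⟨isCompact_closedBall _ _, hB₀, poin_ball hp _ hr₀, hmem _ _ hr₀⟩
  have hΩU : Ω ⊆ U := by
    apply hc.isPreconnected.subset_of_closure_inter_subset hUo
    · exact ⟨x₀, hx₀, _, hP₀, hmem _ _ hr₀⟩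
    · rintro x ⟨hxc, hxΩ⟩
      obtain ⟨r, hr, hB⟩ := hball x hxΩ
      obtain ⟨y, hy, D, hD, hyD⟩ := mem_closure_iff_nhds.1 hxc _ (Metric.ball_mem_nhds x hr)
      refine ⟨D ∪ Metric.closedBall x r, ⟨hD.1.union (isCompact_closedBall _ _),
        Set.union_subset hD.2.1 hB, poin_union hp hD.1 (isCompact_closedBall _ _) hD.2.2.1
          (poin_ball hp _ hr) (vol_inter_ne hyD (Metric.ball_subset_interior_closedBall hy)),
          interior_mono Set.subset_union_left hD.2.2.2⟩, 
          interior_mono Set.subset_union_right (hmem _ _ hr)⟩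
  have : ∃ D, P D ∧ K ⊆ D := by
    refine hK.induction_on (p := fun s => ∃ D, P D ∧ s ⊆ D) ⟨_, hP₀, Set.empty_subset _⟩ ?_ ?_ ?_
    · rintro s t hst ⟨D, hD, h⟩; exact ⟨D, hD, hst.trans h⟩
    · rintro s t ⟨D, hD, h⟩ ⟨D', hD', h'⟩
      exact ⟨D ∪ D', hPu _ _ hD hD', Set.union_subset_union h h'⟩
    · intro x hx
      obtain ⟨D, hD, h⟩ := hΩU (hKΩ hx)
      exact ⟨interior D, mem_nhdsWithin_of_mem_nhds (isOpen_interior.mem_nhds h), D, hD,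
        interior_subset⟩
  obtain ⟨D, hD, h⟩ := this
  exact ⟨D, hD.1, h, hD.2.1, hD.2.2.1⟩

lemma poin_weight {p : ℝ} (hp : 1 < p) {D : Set (Ed d)} (hD : IsCompact D) (hP : Poin p D)
    {ρ : Ed d → ℝ} (hρ : ContinuousOn ρ D) (hm : ∫ x in D, ρ x ≠ 0) :
    ∃ C : ℝ, 0 ≤ C ∧ ∀ w : Ed d → ℝ, ContDiff ℝ 1 w →
      ∫ x in D, |w x| ^ p ≤ C * ((∫ x in D, ‖gradient w x‖ ^ p) + |∫ x in D, ρ x * w x| ^ p) := by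
  obtain ⟨C₁, hC₁, h₁⟩ := hP
  have hp0 : 0 < p := by linarith
  set m := ∫ x in D, ρ x with hmdef
  obtain ⟨M, hM⟩ := hD.exists_bound_of_continuousOn hρ
  have hmp : 0 < |m| ^ p := Real.rpow_pos_of_pos (abs_pos.2 hm) _
  set A := max M 0 with hA
  have hA0 : 0 ≤ A := le_max_right _ _
  set v := volume.real D with hv
  have hv0 : 0 ≤ v := measureReal_nonneg
  set C₂ := A ^ p * (v ^ (p - 1) * C₁) with hC₂
  have hC₂0 : 0 ≤ C₂ := by positivity
  set C₃ := 2 ^ p * (1 + C₂) / |m| ^ p with hC₃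
  have hC₃0 : 0 ≤ C₃ := by positivity
  refine ⟨2 ^ p * (C₁ + C₃ * v), by positivity, fun w hw => ?_⟩
  obtain ⟨k, hk⟩ := h₁ w hw
  set X := ∫ x in D, ‖gradient w x‖ ^ p with hX
  have hX0 : 0 ≤ X := integral_nonneg fun x => by positivity
  set J := |∫ x in D, ρ x * w x| ^ p with hJ
  have hJ0 : 0 ≤ J := by positivity
  have hwk : ContinuousOn (fun x => w x - k) D := (hw.continuous.sub continuous_const).continuousOn
  have i1 : IntegrableOn (fun x => ρ x * w x) D :=
    (hρ.mul hw.continuous.continuousOn).integrableOn_compact hD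
  have i2 : IntegrableOn (fun x => ρ x * (w x - k)) D := (hρ.mul hwk).integrableOn_compact hD
  have e1 : m * k = (∫ x in D, ρ x * w x) + -(∫ x in D, ρ x * (w x - k)) := by
    rw [← sub_eq_add_neg, ← integral_sub i1 i2, hmdef, ← integral_mul_const]
    congr 1; ext x; ring
  have e2 : |∫ x in D, ρ x * (w x - k)| ^ p ≤ C₂ * X := by
    have b1 : |∫ x in D, ρ x * (w x - k)| ≤ A * ∫ x in D, |w x - k| := by
      rw [← integral_const_mul]
      refine (abs_integral_le_integral_abs).trans ?_
      refine integral_mono_ae i2.abs ?_ ?_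
      · exact (hwk.abs.integrableOn_compact hD).const_mul _
      · filter_upwards [ae_restrict_mem hD.measurableSet] with x hx
        rw [abs_mul]
        gcongr
        exact (hM x hx).trans (le_max_left _ _)
    calc _ ≤ _ := Real.rpow_le_rpow (abs_nonneg _) b1 hp0.le
      _ = A ^ p * (∫ x in D, |w x - k|) ^ p := by
        rw [Real.mul_rpow hA0 (integral_nonneg fun x => abs_nonneg _)]
      _ ≤ A ^ p * (v ^ (p - 1) * ∫ x in D, |w x - k| ^ p) := by
        gcongr; exact jensen_compact hp hD hwk
      _ ≤ A ^ p * (v ^ (p - 1) * (C₁ * X)) := by gcongr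
      _ = _ := by rw [hC₂]; ring
  have e3 : |m| ^ p * |k| ^ p ≤ 2 ^ p * (J + C₂ * X) := by
    rw [← Real.mul_rpow (abs_nonneg _) (abs_nonneg _), ← abs_mul, e1]
    refine (abs_np_add hp _ _).trans ?_
    rw [abs_neg]
    gcongr
  have e4 : |k| ^ p ≤ C₃ * (X + J) := by
    rw [hC₃, div_mul_eq_mul_div, le_div_iff₀ hmp, mul_comm]
    have e5 : J + C₂ * X ≤ (1 + C₂) * (X + J) := by nlinarith [mul_nonneg hC₂0 hJ0]
    have e6 : (2:ℝ) ^ p * (J + C₂ * X) ≤ 2 ^ p * ((1 + C₂) * (X + J)) :=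
      mul_le_mul_of_nonneg_left e5 (by positivity)
    linarith [e3]
  calc ∫ x in D, |w x| ^ p ≤ ∫ x in D, 2 ^ p * (|w x - k| ^ p + |k| ^ p) := by
          refine integral_mono_of_nonneg (Eventually.of_forall fun x => by positivity)
            (((intOn_pow hp hw.continuous.continuousOn k hD).add
              (integrableOn_const hD.measure_lt_top.ne)).const_mul _)
            (Eventually.of_forall fun x => ?_)
          have := abs_np_add hp (w x - k) k
          simpa using this
    _ = 2 ^ p * ((∫ x in D, |w x - k| ^ p) + |k| ^ p * v) := by
          rw [integral_const_mul, integral_add (intOn_pow hp hw.continuous.continuousOn k hD)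
            (integrableOn_const hD.measure_lt_top.ne)]
          simp [mul_comm, hv]
    _ ≤ 2 ^ p * (C₁ * (X + J) + C₃ * (X + J) * v) := by
          gcongr
          refine hk.trans ?_
          gcongr; linarith
    _ = _ := by ring
end Poincare2

section Part4
variable {d : ℕ}

def C1c (Ω : Set (Ed d)) (v : Ed d → ℝ) : Prop :=
  ContDiff ℝ 1 v ∧ HasCompactSupport v ∧ tsupport v ⊆ Ω

lemma IsTestOn.c1c {Ω : Set (Ed d)} {v : Ed d → ℝ} (h : IsTestOn Ω v) : C1c Ω v :=
  ⟨h.1.of_le (by exact_mod_cast le_top), h.2⟩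

lemma cutoff {Ω K : Set (Ed d)} (ho : IsOpen Ω) (hK : IsCompact K) (hKΩ : K ⊆ Ω) :
    ∃ χ : Ed d → ℝ, IsTestOn Ω χ ∧ (∀ x, 0 ≤ χ x ∧ χ x ≤ 1) ∧
      ∃ U, IsOpen U ∧ K ⊆ U ∧ ∀ x ∈ U, χ x = 1 := by
  obtain ⟨L, hL, hKL, hLΩ⟩ := exists_compact_between hK ho hKΩ
  obtain ⟨L', hL', hLL', hLΩ'⟩ := exists_compact_between hL ho hLΩ
  obtain ⟨f, hf, hr, hs, h1⟩ := exists_contMDiff_support_eq_eq_one_iff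
    (modelWithCornersSelf ℝ (Ed d)) (n := (⊤ : ℕ∞)) (isOpen_interior (s := L')) hL.isClosed hLL'
  have hsub : tsupport f ⊆ L' := by
    rw [tsupport, hs]; exact closure_minimal interior_subset hL'.isClosed
  refine ⟨f, ⟨?_, hL'.of_isClosed_subset (isClosed_tsupport f) hsub, hsub.trans hLΩ'⟩, fun x => ?_,
    interior L, isOpen_interior, hKL, fun x hx => (h1 x).1 (interior_subset hx)⟩
  · exact contMDiff_iff_contDiff.1 hf
  · exact hr (Set.mem_range_self x)

lemma grad_zero {v : Ed d → ℝ} {x : Ed d} (hx : x ∉ tsupport v) : gradient v x = 0 := by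
  have h := (notMem_tsupport_iff_eventuallyEq.1 hx).fderiv_eq (𝕜 := ℝ)
  rw [gradient, h]
  have : fderiv ℝ (0 : Ed d → ℝ) x = 0 := by simp
  rw [this]; simp

lemma zero_out {v : Ed d → ℝ} {x : Ed d} (hx : x ∉ tsupport v) : v x = 0 :=
  image_eq_zero_of_notMem_tsupport hx

lemma intV {Ω K : Set (Ed d)} {V f : Ed d → ℝ} (hV : LocBddOn Ω V) (hK : IsCompact K)
    (hKΩ : K ⊆ Ω) (hf : IntegrableOn f K) : IntegrableOn (fun x => V x * f x) K := by
  obtain ⟨M, hM⟩ := hV.2 K hK hKΩ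
  refine Integrable.bdd_mul (c := M) hf hV.1.aestronglyMeasurable ?_
  filter_upwards [ae_restrict_of_ae hM, ae_restrict_mem hK.measurableSet] with x h1 h2
  exact h1 h2

lemma cont_pow {p : ℝ} (hp : 1 < p) {v : Ed d → ℝ} {K : Set (Ed d)} (hv : ContinuousOn v K) :
    ContinuousOn (fun x => |v x| ^ p) K :=
  hv.abs.rpow_const (fun _ _ => Or.inr (by linarith))

lemma Q_eq {p : ℝ} (hp : 1 < p) {Ω K : Set (Ed d)} {V v : Ed d → ℝ} (ho : IsOpen Ω)
    (hvK : tsupport v ⊆ K) (hKΩ : K ⊆ Ω) :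
    Qp p Ω V v = ∫ x in K, (‖gradient v x‖ ^ p + V x * |v x| ^ p) := by
  refine setIntegral_eq_of_subset_of_forall_sdiff_eq_zero ho.measurableSet hKΩ fun x hx => ?_
  have : x ∉ tsupport v := fun h => hx.2 (hvK h)
  rw [grad_zero this, zero_out this]
  simp [Real.zero_rpow (by linarith : p ≠ 0)]

lemma mollify {v : Ed d → ℝ} (hv : ContDiff ℝ 1 v) (hc : HasCompactSupport v) {δ : ℝ} (hδ : 0 < δ)
    {r : ℝ} (hr : 0 < r) :
    ∃ v' : Ed d → ℝ, ContDiff ℝ (⊤ : ℕ∞) v' ∧ tsupport v' ⊆ Metric.cthickening r (tsupport v) ∧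
      (∀ x, |v' x - v x| ≤ δ) ∧ ∀ x, ‖gradient v' x - gradient v x‖ ≤ δ := by
  have hcf : HasCompactSupport (fderiv ℝ v) := hc.fderiv ℝ
  have hfc : Continuous (fderiv ℝ v) := hv.continuous_fderiv (by simp)
  obtain ⟨r₁, hr₁, h₁⟩ := Metric.uniformContinuous_iff.1
    (hc.uniformContinuous_of_continuous hv.continuous) δ hδ
  obtain ⟨r₂, hr₂, h₂⟩ := Metric.uniformContinuous_iff.1
    (hcf.uniformContinuous_of_continuous hfc) δ hδ
  set ρ := min r (min r₁ r₂) with hρ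
  have hρ0 : 0 < ρ := by positivity
  set b : ContDiffBump (0 : Ed d) := ⟨ρ / 2, ρ, half_pos hρ0, half_lt_self hρ0⟩ with hb
  set L := ContinuousLinearMap.lsmul ℝ ℝ (E := ℝ) with hL
  have hli : LocallyIntegrable (b.normed volume) volume :=
    (b.continuous_normed (μ := volume)).locallyIntegrable
  set v' := convolution (b.normed volume) v L volume with hv'
  have hd : ∀ x, ‖fderiv ℝ v' x - fderiv ℝ v x‖ ≤ δ := by
    intro x
    have h := hc.hasFDerivAt_convolution_right L (μ := volume) hli hv x
    have hLe : L.precompR (Ed d) = ContinuousLinearMap.lsmul ℝ ℝ (E := Ed d →L[ℝ] ℝ) := by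
      ext a f y; simp [hL]
    rw [hLe] at h
    rw [h.fderiv, ← dist_eq_norm]
    refine b.dist_normed_convolution_le hfc.aestronglyMeasurable fun y hy => ?_
    refine (h₂ (lt_of_lt_of_le hy ?_)).le
    exact (min_le_right _ _).trans (min_le_right _ _)
  refine ⟨v', ?_, ?_, fun x => ?_, fun x => ?_⟩
  · exact b.hasCompactSupport_normed.contDiff_convolution_left _ b.contDiff_normed
      hv.continuous.locallyIntegrable
  · refine closure_minimal ?_ Metric.isClosed_cthickening
    intro x hx
    obtain ⟨y, hy, z, hz, rfl⟩ := support_convolution_subset L hx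
    rw [b.support_normed_eq] at hy
    refine Metric.mem_cthickening_of_dist_le _ z _ _ (subset_closure hz) ?_
    have : ‖y‖ < ρ := by simpa using hy
    simp only [dist_eq_norm, add_sub_cancel_right]
    exact this.le.trans (min_le_left _ _)
  · rw [← Real.dist_eq]
    refine b.dist_normed_convolution_le hv.continuous.aestronglyMeasurable fun y hy => ?_
    refine (h₁ (lt_of_lt_of_le hy ?_)).le
    exact (min_le_right _ _).trans (min_le_left _ _)
  · rw [gradient, gradient, ← map_sub, LinearIsometryEquiv.norm_map]
    exact hd x

lemma Q_nonneg {p : ℝ} (hp : 1 < p) {Ω : Set (Ed d)} {V v : Ed d → ℝ} (ho : IsOpen Ω)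
    (hV : LocBddOn Ω V) (hnn : NonnegOn p Ω V) (hv : C1c Ω v) : 0 ≤ Qp p Ω V v := by
  obtain ⟨hv1, hvc, hvΩ⟩ := hv
  have hp0 : 0 < p := by linarith
  obtain ⟨r, hr, hrΩ⟩ := hvc.exists_cthickening_subset_open ho hvΩ
  set K := Metric.cthickening r (tsupport v) with hK
  have hKc : IsCompact K := IsCompact.cthickening hvc
  choose w hw1 hw2 hw3 hw4 using fun n : ℕ => mollify hv1 hvc
    (δ := 1 / ((n:ℝ) + 1)) (by positivity) hr
  have hwt : ∀ n, IsTestOn Ω (w n) := fun n => ⟨hw1 n,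
    hKc.of_isClosed_subset (isClosed_tsupport _) (hw2 n), (hw2 n).trans hrΩ⟩
  have h0 : ∀ n, 0 ≤ ∫ x in K, (‖gradient (w n) x‖ ^ p + V x * |w n x| ^ p) := fun n => by
    rw [← Q_eq hp ho (hw2 n) hrΩ]; exact hnn _ (hwt n)
  rw [Q_eq hp ho (Metric.self_subset_cthickening _) hrΩ]
  have hle1 : ∀ n : ℕ, 1 / ((n:ℝ) + 1) ≤ 1 := fun n => by
    rw [div_le_one (by positivity)]; linarith [Nat.cast_nonneg (α := ℝ) n]
  have hc1 : Continuous fun x => (‖gradient v x‖ + 1) ^ p :=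
    ((cont_gradient hv1).norm.add continuous_const).rpow_const (fun _ => Or.inr hp0.le)
  have hc2 : Continuous fun x => (|v x| + 1) ^ p :=
    (hv1.continuous.abs.add continuous_const).rpow_const (fun _ => Or.inr hp0.le)
  refine ge_of_tendsto' (tendsto_integral_of_dominated_convergence
    (fun x => (‖gradient v x‖ + 1) ^ p + |V x * (|v x| + 1) ^ p|) (fun n => ?_) ?_ (fun n => ?_) ?_)
    h0
  · have := cont_normgrad (hwt n).c1c.1 hp
    refine this.aestronglyMeasurable.add (hV.1.aestronglyMeasurable.mul ?_)
    exact (((hw1 n).continuous.abs).rpow_const (fun _ => Or.inr hp0.le)).aestronglyMeasurable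
  · exact (hc1.continuousOn.integrableOn_compact hKc).add
      (intV hV hKc hrΩ (hc2.continuousOn.integrableOn_compact hKc)).abs
  · refine Eventually.of_forall fun x => ?_
    refine (norm_add_le _ _).trans ?_
    rw [Real.norm_of_nonneg (by positivity), Real.norm_eq_abs, abs_mul, abs_mul]
    have a1 : ‖gradient (w n) x‖ ≤ ‖gradient v x‖ + 1 := by
      have := norm_le_insert' (gradient (w n) x) (gradient v x)
      linarith [hw4 n x, hle1 n]
    have a2 : |w n x| ≤ |v x| + 1 := by
      have := norm_le_insert' (w n x) (v x)
      simp only [Real.norm_eq_abs] at this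
      linarith [hw3 n x, hle1 n]
    have b1 := Real.rpow_le_rpow (norm_nonneg _) a1 hp0.le
    have b2 := Real.rpow_le_rpow (abs_nonneg _) a2 hp0.le
    refine add_le_add b1 (mul_le_mul_of_nonneg_left ?_ (abs_nonneg _))
    rw [abs_of_nonneg (show 0 ≤ |w n x| ^ p by positivity),
      abs_of_nonneg (show 0 ≤ (|v x| + 1) ^ p by positivity)]
    exact b2
  · refine Eventually.of_forall fun x => ?_
    have t1 : Tendsto (fun n => gradient (w n) x) atTop (𝓝 (gradient v x)) := by
      rw [tendsto_iff_norm_sub_tendsto_zero]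
      exact squeeze_zero (fun _ => norm_nonneg _) (fun n => hw4 n x)
        tendsto_one_div_add_atTop_nhds_zero_nat
    have t2 : Tendsto (fun n => w n x) atTop (𝓝 (v x)) := by
      rw [tendsto_iff_norm_sub_tendsto_zero]
      exact squeeze_zero (fun _ => norm_nonneg _) (fun n => hw3 n x)
        tendsto_one_div_add_atTop_nhds_zero_nat
    exact (t1.norm.rpow_const (Or.inr hp0.le)).add
      ((t2.abs.rpow_const (Or.inr hp0.le)).const_mul _)
end Part4

section Part5
variable {d : ℕ}

lemma grad_add {f g : Ed d → ℝ} {x : Ed d} (hf : DifferentiableAt ℝ f x)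
    (hg : DifferentiableAt ℝ g x) :
    gradient (fun y => f y + g y) x = gradient f x + gradient g x := by
  rw [gradient, gradient, gradient, fderiv_fun_add hf hg, map_add]

lemma grad_sub {f g : Ed d → ℝ} {x : Ed d} (hf : DifferentiableAt ℝ f x)
    (hg : DifferentiableAt ℝ g x) :
    gradient (fun y => f y - g y) x = gradient f x - gradient g x := by
  rw [gradient, gradient, gradient, fderiv_fun_sub hf hg, map_sub]

lemma grad_mul {f g : Ed d → ℝ} {x : Ed d} (hf : DifferentiableAt ℝ f x)
    (hg : DifferentiableAt ℝ g x) :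
    gradient (fun y => f y * g y) x = f x • gradient g x + g x • gradient f x := by
  rw [gradient, gradient, gradient, fderiv_fun_mul hf hg, map_add, map_smulₛₗ, map_smulₛₗ]
  simp

lemma grad_comp {f : Ed d → ℝ} {x : Ed d} {q : ℝ → ℝ} {q' : ℝ} (hq : HasDerivAt q q' (f x))
    (hf : DifferentiableAt ℝ f x) :
    gradient (fun y => q (f y)) x = q' • gradient f x := by
  have : HasFDerivAt (fun y => q (f y)) (q' • fderiv ℝ f x) x :=
    hq.comp_hasFDerivAt x hf.hasFDerivAt
  rw [gradient, gradient, this.fderiv, map_smulₛₗ]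
  simp

lemma grad_congr {f g : Ed d → ℝ} {x : Ed d} (h : f =ᶠ[𝓝 x] g) : gradient f x = gradient g x := by
  rw [gradient, gradient, h.fderiv_eq]

lemma C1.diff {f : Ed d → ℝ} (h : ContDiff ℝ 1 f) (x : Ed d) : DifferentiableAt ℝ f x :=
  (h.differentiable (by simp)) x

/-- pointwise estimate -/
lemma master_pt {p : ℝ} (hp : 1 < p) {m : ℕ} (hm2 : 2 ≤ m) (hmp : p ≤ m) {χ : Ed d → ℝ}
    (hχ : ContDiff ℝ 1 χ) (hχ01 : ∀ x, 0 ≤ χ x ∧ χ x ≤ 1) {G : ℝ}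
    (hG : ∀ x, ‖gradient χ x‖ ≤ G) {Φ h : Ed d → ℝ} (hΦ : ContDiff ℝ 1 Φ) (hh : ContDiff ℝ 1 h)
    {U : Set (Ed d)} (hU : IsOpen U) (hhU : tsupport h ⊆ U) (hχU : ∀ x ∈ U, χ x = 1)
    {ε : ℝ} {C : ℝ} (hC : 0 ≤ C)
    (hCε : ∀ a b : Ed d, ‖a‖ ^ p ≤ (1 + ε) * ‖b‖ ^ p + C * ‖a - b‖ ^ p)
    {u : Ed d → ℝ} (hu : ContDiff ℝ 1 u) (x : Ed d) :
    ‖gradient (fun y => u y + χ y ^ m * (Φ y + h y - u y)) x‖ ^ p ≤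
      (1 - χ x ^ m) * ‖gradient u x‖ ^ p
        + (1 + ε) * (χ x ^ m * ‖gradient (fun y => Φ y + h y) x‖ ^ p)
        + C * (m * G) ^ p * |Φ x - u x| ^ p := by
  have hp0 : 0 < p := by linarith
  have hη : ContDiff ℝ 1 (fun y => χ y ^ m) := hχ.pow m
  have hg : ContDiff ℝ 1 (fun y => Φ y + h y) := hΦ.add hh
  have hgu : ContDiff ℝ 1 (fun y => Φ y + h y - u y) := hg.sub hu
  have hG0 : 0 ≤ G := (norm_nonneg _).trans (hG x)
  have eη : gradient (fun y => χ y ^ m) x = ((m : ℝ) * χ x ^ (m - 1)) • gradient χ x :=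
    grad_comp (hasDerivAt_pow m _) (C1.diff hχ x)
  have e1 : gradient (fun y => u y + χ y ^ m * (Φ y + h y - u y)) x =
      gradient u x + (χ x ^ m • (gradient (fun y => Φ y + h y) x - gradient u x)
        + (Φ x + h x - u x) • gradient (fun y => χ y ^ m) x) := by
    rw [grad_add (C1.diff hu x) (C1.diff (hη.mul hgu) x), grad_mul (C1.diff hη x) (C1.diff hgu x),
      grad_sub (C1.diff hg x) (C1.diff hu x)]
  have e2 : (Φ x + h x - u x) • gradient (fun y => χ y ^ m) x =
      (Φ x - u x) • gradient (fun y => χ y ^ m) x := by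
    by_cases hx : x ∈ tsupport h
    · have : gradient (fun y => χ y ^ m) x = 0 := by
        have h1 : (fun y => χ y ^ m) =ᶠ[𝓝 x] fun _ => 1 := by
          filter_upwards [hU.mem_nhds (hhU hx)] with y hy
          rw [hχU y hy, one_pow]
        rw [grad_congr h1]; simp [gradient]
      rw [this, smul_zero, smul_zero]
    · rw [zero_out hx, add_zero]
  rw [e1, e2, eη]
  obtain ⟨h0, h1⟩ := hχ01 x
  set g' := gradient (fun y => Φ y + h y) x
  set u' := gradient u x
  set s := Φ x - u x
  rcases h0.eq_or_lt with hz | hpos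
  · rw [← hz, zero_pow (by omega), zero_pow (by omega)]
    simp only [zero_smul, mul_zero, smul_zero, add_zero, sub_zero, one_mul, zero_mul]
    have : 0 ≤ C * (m * G) ^ p * |s| ^ p := by positivity
    linarith
  · set c := χ x with hc
    set z : Ed d := (s * (m * c⁻¹)) • gradient χ x with hz
    have hη0 : 0 ≤ c ^ m := by positivity
    have hη1 : c ^ m ≤ 1 := pow_le_one₀ h0 h1
    have e3 : u' + (c ^ m • (g' - u') + s • ((m : ℝ) * c ^ (m - 1)) • gradient χ x) =
        (1 - c ^ m) • u' + c ^ m • (g' + z) := by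
      have : c ^ m = c ^ (m - 1) * c := by rw [← pow_succ]; congr 1; omega
      have e4 : c ^ m • z = s • ((m : ℝ) * c ^ (m - 1)) • gradient χ x := by
        rw [hz, smul_smul, smul_smul]; congr 1; rw [this]; field_simp
      rw [smul_add, e4]; module
    rw [e3]
    refine (np_conv hp hη0 hη1 _ _).trans ?_
    have h2 := hCε (g' + z) g'
    rw [add_sub_cancel_left] at h2
    have h3 : c ^ m * ‖z‖ ^ p ≤ (m * G) ^ p * |s| ^ p := by
      have hz1 : ‖z‖ ≤ c⁻¹ * (m * G * |s|) := by
        rw [hz, norm_smul, Real.norm_eq_abs, abs_mul, abs_of_nonneg (by positivity : 0 ≤ (m:ℝ) * c⁻¹)]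
        have := mul_le_mul_of_nonneg_left (hG x) (by positivity : 0 ≤ |s| * (m * c⁻¹))
        calc _ ≤ _ := this
          _ = _ := by ring
      calc c ^ m * ‖z‖ ^ p ≤ c ^ m * (c⁻¹ * (m * G * |s|)) ^ p := by gcongr
        _ = (c ^ m * (c⁻¹) ^ p) * ((m * G) ^ p * |s| ^ p) := by
          rw [Real.mul_rpow (by positivity) (by positivity),
            Real.mul_rpow (by positivity) (by positivity)]; ring
        _ ≤ 1 * ((m * G) ^ p * |s| ^ p) := by
          refine mul_le_mul_of_nonneg_right ?_ (by positivity)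
          rw [Real.inv_rpow h0, ← div_eq_mul_inv, div_le_one (by positivity), ← Real.rpow_natCast]
          exact Real.rpow_le_rpow_of_exponent_ge hpos h1 hmp
        _ = _ := one_mul _
    calc (1 - c ^ m) * ‖u'‖ ^ p + c ^ m * ‖g' + z‖ ^ p
        ≤ (1 - c ^ m) * ‖u'‖ ^ p + c ^ m * ((1 + ε) * ‖g'‖ ^ p + C * ‖z‖ ^ p) := by gcongr
      _ = (1 - c ^ m) * ‖u'‖ ^ p + (1 + ε) * (c ^ m * ‖g'‖ ^ p) + C * (c ^ m * ‖z‖ ^ p) := by ring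
      _ ≤ (1 - c ^ m) * ‖u'‖ ^ p + (1 + ε) * (c ^ m * ‖g'‖ ^ p)
          + C * ((m * G) ^ p * |s| ^ p) := by gcongr
      _ = _ := by ring

lemma master {p : ℝ} (hp : 1 < p) {Ω : Set (Ed d)} {V : Ed d → ℝ} (ho : IsOpen Ω)
    (hV : LocBddOn Ω V) (hnn : NonnegOn p Ω V) {m : ℕ} (hm2 : 2 ≤ m) (hmp : p ≤ m) {χ : Ed d → ℝ}
    (hχ : IsTestOn Ω χ) (hχ01 : ∀ x, 0 ≤ χ x ∧ χ x ≤ 1)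
    {Φ h : Ed d → ℝ} (hΦ : ContDiff ℝ 1 Φ) (hh : ContDiff ℝ 1 h)
    {U : Set (Ed d)} (hU : IsOpen U) (hhU : tsupport h ⊆ U) (hχU : ∀ x ∈ U, χ x = 1)
    {ε : ℝ} (hε : 0 < ε) : ∃ C : ℝ, ∀ u, IsTestOn Ω u →
    ∫ x in tsupport χ, χ x ^ m * ‖gradient u x‖ ^ p ≤ Qp p Ω V u
      + (1 + ε) * (∫ x in tsupport χ, χ x ^ m * ‖gradient (fun y => Φ y + h y) x‖ ^ p)
      + C * (∫ x in tsupport χ, |u x - Φ x| ^ p)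
      + ((∫ x in tsupport χ, V x * |u x + χ x ^ m * (Φ x + h x - u x)| ^ p)
        - ∫ x in tsupport χ, V x * |u x| ^ p) := by
  have hp0 : 0 < p := by linarith
  obtain ⟨C, hC, hCε⟩ := np_one hp hε
  have hχ1 := hχ.c1c.1
  obtain ⟨G, hG⟩ : ∃ G, ∀ x, ‖gradient χ x‖ ≤ G := by
    obtain ⟨G, hG⟩ := IsCompact.exists_bound_of_continuousOn (hχ.2.1 : IsCompact (tsupport χ))
      (cont_gradient hχ1).continuousOn
    refine ⟨max G 0, fun x => ?_⟩
    by_cases hx : x ∈ tsupport χ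
    · exact (hG x hx).trans (le_max_left _ _)
    · rw [grad_zero hx, norm_zero]; exact le_max_right _ _
  refine ⟨C * (m * G) ^ p, fun u hu => ?_⟩
  have hu1 := hu.c1c.1
  have hpt := master_pt hp hm2 hmp hχ1 hχ01 hG hΦ hh hU hhU hχU hC (hCε (Ed d)) hu1
  set v : Ed d → ℝ := fun y => u y + χ y ^ m * (Φ y + h y - u y) with hv
  have hv1 : ContDiff ℝ 1 v := hu1.add ((hχ1.pow m).mul ((hΦ.add hh).sub hu1))
  set D := tsupport χ with hD
  have hDc : IsCompact D := hχ.2.1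
  set K := D ∪ tsupport u with hK
  have hKc : IsCompact K := hDc.union hu.2.1
  have hKΩ : K ⊆ Ω := Set.union_subset hχ.2.2 hu.2.2
  have hveq : ∀ x, x ∉ D → v =ᶠ[𝓝 x] u := by
    intro x hx
    filter_upwards [notMem_tsupport_iff_eventuallyEq.1 hx] with y hy
    rw [hv]; simp only []; rw [hy]
    simp [zero_pow (by omega : m ≠ 0)]
  have hvK : tsupport v ⊆ K := by
    intro x hx
    by_contra hxK
    have h1 : x ∉ D := fun h => hxK (Or.inl h)
    have h2 : x ∉ tsupport u := fun h => hxK (Or.inr h)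
    exact (notMem_tsupport_iff_eventuallyEq.2
      ((hveq x h1).trans (notMem_tsupport_iff_eventuallyEq.1 h2))) hx
  have hQ := Q_nonneg hp ho hV hnn
    (v := v) ⟨hv1, hKc.of_isClosed_subset (isClosed_tsupport _) hvK, hvK.trans hKΩ⟩
  rw [Q_eq hp ho hvK hKΩ] at hQ
  rw [Q_eq hp ho (Set.subset_union_right : tsupport u ⊆ K) hKΩ]
  have iG : ∀ w : Ed d → ℝ, ContDiff ℝ 1 w → ∀ S, IsCompact S →
      IntegrableOn (fun x => ‖gradient w x‖ ^ p) S := fun w hw S hS =>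
    (cont_normgrad hw hp).continuousOn.integrableOn_compact hS
  have iηG : ∀ w : Ed d → ℝ, ContDiff ℝ 1 w → 
      IntegrableOn (fun x => χ x ^ m * ‖gradient w x‖ ^ p) D := fun w hw =>
    ((hχ1.continuous.pow m).mul (cont_normgrad hw hp)).continuousOn.integrableOn_compact hDc
  have iP : ∀ w : Ed d → ℝ, ContDiff ℝ 1 w → ∀ S, IsCompact S →
      IntegrableOn (fun x => |w x| ^ p) S := fun w hw S hS =>
    (cont_pow hp hw.continuous.continuousOn).integrableOn_compact hS
  have iV : ∀ w : Ed d → ℝ, ContDiff ℝ 1 w → ∀ S, IsCompact S → S ⊆ Ω →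
      IntegrableOn (fun x => V x * |w x| ^ p) S := fun w hw S hS hSΩ =>
    intV hV hS hSΩ (iP w hw S hS)
  have iQ : ∀ w : Ed d → ℝ, ContDiff ℝ 1 w → ∀ S, IsCompact S → S ⊆ Ω →
      IntegrableOn (fun x => ‖gradient w x‖ ^ p + V x * |w x| ^ p) S := fun w hw S hS hSΩ =>
    (iG w hw S hS).add (iV w hw S hS hSΩ)
  have key : (∫ x in K, (‖gradient v x‖ ^ p + V x * |v x| ^ p)) -
      ∫ x in K, (‖gradient u x‖ ^ p + V x * |u x| ^ p) =
      ∫ x in D, ((‖gradient v x‖ ^ p + V x * |v x| ^ p) -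
        (‖gradient u x‖ ^ p + V x * |u x| ^ p)) := by
    rw [← integral_sub (iQ v hv1 K hKc hKΩ) (iQ u hu1 K hKc hKΩ)]
    refine setIntegral_eq_of_subset_of_forall_sdiff_eq_zero hKc.measurableSet
      Set.subset_union_left fun x hx => ?_
    rw [grad_congr (hveq x hx.2), (hveq x hx.2).self_of_nhds]; ring
  have i3 : IntegrableOn (fun x => |u x - Φ x| ^ p) D := iP _ (hu1.sub hΦ) D hDc
  have hg1 : ContDiff ℝ 1 (fun y => Φ y + h y) := hΦ.add hh
  have key2 : ∫ x in D, ((‖gradient v x‖ ^ p + V x * |v x| ^ p) -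
        (‖gradient u x‖ ^ p + V x * |u x| ^ p)) ≤
      ∫ x in D, ((((1 + ε) * (χ x ^ m * ‖gradient (fun y => Φ y + h y) x‖ ^ p)
        + C * (m * G) ^ p * |u x - Φ x| ^ p) - χ x ^ m * ‖gradient u x‖ ^ p)
        + (V x * |v x| ^ p - V x * |u x| ^ p)) := by
    refine integral_mono (((iG v hv1 D hDc).add (iV v hv1 D hDc hχ.2.2)).sub
      ((iG u hu1 D hDc).add (iV u hu1 D hDc hχ.2.2)))
      (((((iηG _ hg1).const_mul _).add (i3.const_mul _)).sub (iηG _ hu1)).add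
        ((iV v hv1 D hDc hχ.2.2).sub (iV u hu1 D hDc hχ.2.2))) fun x => ?_
    have := hpt x
    rw [abs_sub_comm (Φ x)] at this
    simp only []
    linarith
  have j1 : IntegrableOn (fun x => (1 + ε) * (χ x ^ m * ‖gradient (fun y => Φ y + h y) x‖ ^ p)
        + C * (m * G) ^ p * |u x - Φ x| ^ p) D := ((iηG _ hg1).const_mul _).add (i3.const_mul _)
  have j2 : IntegrableOn (fun x => ((1 + ε) * (χ x ^ m * ‖gradient (fun y => Φ y + h y) x‖ ^ p)
        + C * (m * G) ^ p * |u x - Φ x| ^ p) - χ x ^ m * ‖gradient u x‖ ^ p) D :=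
    j1.sub (iηG _ hu1)
  have j3 : IntegrableOn (fun x => V x * |v x| ^ p - V x * |u x| ^ p) D :=
    (iV v hv1 D hDc hχ.2.2).sub (iV u hu1 D hDc hχ.2.2)
  rw [integral_add j2 j3, integral_sub j1 (iηG _ hu1),
      integral_add ((iηG _ hg1).const_mul _) (i3.const_mul _),
      integral_sub (iV v hv1 D hDc hχ.2.2) (iV u hu1 D hDc hχ.2.2),
      integral_const_mul, integral_const_mul] at key2
  linarith

lemma lp_conv {p : ℝ} (hp : 1 < p) {Ω D : Set (Ed d)} {V : Ed d → ℝ} (hV : LocBddOn Ω V)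
    (hD : IsCompact D) (hDΩ : D ⊆ Ω) {a : ℕ → Ed d → ℝ} {b : Ed d → ℝ}
    (ha : ∀ n, ContinuousOn (a n) D) (hb : ContinuousOn b D)
    (h : Tendsto (fun n => ∫ x in D, |a n x - b x| ^ p) atTop (𝓝 0)) :
    Tendsto (fun n => ∫ x in D, V x * |a n x| ^ p) atTop (𝓝 (∫ x in D, V x * |b x| ^ p)) := by
  obtain ⟨M, hM⟩ := hV.2 D hD hDΩ
  set A := max M 0 with hA
  have hA0 : 0 ≤ A := le_max_right _ _
  have ia : ∀ n, IntegrableOn (fun x => |a n x| ^ p) D := fun n =>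
    (cont_pow hp (ha n)).integrableOn_compact hD
  have ib : IntegrableOn (fun x => |b x| ^ p) D := (cont_pow hp hb).integrableOn_compact hD
  have iab : ∀ n, IntegrableOn (fun x => |a n x - b x| ^ p) D := fun n =>
    (cont_pow hp ((ha n).sub hb)).integrableOn_compact hD
  set B := ∫ x in D, |b x| ^ p with hB
  have hB0 : 0 ≤ B := integral_nonneg fun x => by positivity
  rw [Metric.tendsto_atTop]
  intro ε hε
  set ε' := ε / (2 * (A * B + 1)) with hε'
  have hε'0 : 0 < ε' := by positivity
  obtain ⟨C, hC, hC2⟩ := np_two hp hε'0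
  have hlim : Tendsto (fun n => A * (C * ∫ x in D, |a n x - b x| ^ p)) atTop (𝓝 0) := by
    simpa using (h.const_mul C).const_mul A
  obtain ⟨N, hN⟩ := (Metric.tendsto_atTop.1 hlim) (ε / 2) (by positivity)
  refine ⟨N, fun n hn => ?_⟩
  have hbd : |(∫ x in D, V x * |a n x| ^ p) - ∫ x in D, V x * |b x| ^ p| ≤
      A * (ε' * B + C * ∫ x in D, |a n x - b x| ^ p) := by
    rw [← integral_sub (intV hV hD hDΩ (ia n)) (intV hV hD hDΩ ib), hB,
      ← integral_const_mul, ← integral_const_mul,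
      ← integral_add (ib.const_mul _) ((iab n).const_mul _), ← integral_const_mul]
    refine abs_integral_le_integral_abs.trans ?_
    refine integral_mono_ae ((intV hV hD hDΩ (ia n)).sub (intV hV hD hDΩ ib)).abs
      (((ib.const_mul _).add ((iab n).const_mul _)).const_mul _) ?_
    filter_upwards [ae_restrict_of_ae hM, ae_restrict_mem hD.measurableSet] with x h1 h2
    rw [← mul_sub, abs_mul]
    have := hC2 ℝ (a n x) (b x)
    simp only [Real.norm_eq_abs] at this
    exact mul_le_mul ((h1 h2).trans (le_max_left _ _)) this (abs_nonneg _) hA0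
  rw [Real.dist_eq]
  have h3 := hN n hn
  rw [Real.dist_eq, sub_zero] at h3
  have h4 := (le_abs_self _).trans_lt h3
  have h5 : A * (ε' * B) < ε / 2 := by
    have : A * (ε' * B) = ε / 2 * (A * B / (A * B + 1)) := by rw [hε']; field_simp
    rw [this]
    have : A * B / (A * B + 1) < 1 := by rw [div_lt_one (by positivity)]; linarith
    nlinarith
  rw [mul_add] at hbd
  linarith
end Part5

section Part6
variable {d : ℕ}

lemma ibp1 {D : Set (Ed d)} (hD : IsCompact D) {a : Ed d → ℝ} (ha : ContDiff ℝ 1 a)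
    (haD : tsupport a ⊆ D) (e : Ed d) : ∃ C : ℝ, 0 ≤ C ∧ ∀ f : Ed d → ℝ, ContDiff ℝ 1 f →
      |∫ x in D, a x * ⟪gradient f x, e⟫| ≤ C * ∫ x in D, |f x| := by
  have hac : HasCompactSupport a := hD.of_isClosed_subset (isClosed_tsupport _) haD
  have hfa : Continuous (fun x => fderiv ℝ a x e) :=
    (ha.continuous_fderiv (by simp)).clm_apply continuous_const
  obtain ⟨M, hM⟩ := hD.exists_bound_of_continuousOn hfa.continuousOn
  have hfa0 : ∀ x, x ∉ D → fderiv ℝ a x e = 0 := fun x hx => by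
    rw [fderiv_eq_inner, grad_zero (fun h => hx (haD h)), inner_zero_left]
  have ha0 : ∀ x, x ∉ D → a x = 0 := fun x hx => zero_out (fun h => hx (haD h))
  refine ⟨max M 0, le_max_right _ _, fun f hf => ?_⟩
  have hgf : Continuous (fun x => fderiv ℝ f x e) :=
    (hf.continuous_fderiv (by simp)).clm_apply continuous_const
  have cs : ∀ g : Ed d → ℝ, (∀ x, x ∉ D → g x = 0) → HasCompactSupport g := fun g hg =>
    HasCompactSupport.intro hD hg
  have e0 : ∀ g : Ed d → ℝ, (∀ x, x ∉ D → g x = 0) → ∫ x in D, g x = ∫ x, g x := fun g hg =>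
    setIntegral_eq_integral_of_forall_compl_eq_zero hg
  have e1 : ∫ x in D, a x * ⟪gradient f x, e⟫ = -∫ x in D, fderiv ℝ a x e * f x := by
    simp_rw [← fderiv_eq_inner]
    rw [e0 _ (fun x hx => by rw [ha0 x hx, zero_mul]),
      e0 _ (fun x hx => by rw [hfa0 x hx, zero_mul])]
    apply integral_mul_fderiv_eq_neg_fderiv_mul_of_integrable
    · exact (hfa.mul hf.continuous).integrable_of_hasCompactSupport
        (cs _ fun x hx => by simp [hfa0 x hx])
    · exact (ha.continuous.mul hgf).integrable_of_hasCompactSupport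
        (cs _ fun x hx => by simp [ha0 x hx])
    · exact (ha.continuous.mul hf.continuous).integrable_of_hasCompactSupport
        (cs _ fun x hx => by simp [ha0 x hx])
    · exact fun x _ => C1.diff ha x
    · exact fun x _ => C1.diff hf x
  rw [e1, abs_neg, ← integral_const_mul]
  refine abs_integral_le_integral_abs.trans ?_
  refine setIntegral_mono_on ((hfa.mul hf.continuous).abs.continuousOn.integrableOn_compact hD)
    ((hf.continuous.abs.continuousOn.integrableOn_compact hD).const_mul _) hD.measurableSet
    fun x hx => ?_
  rw [abs_mul]
  exact mul_le_mul_of_nonneg_right ((hM x hx).trans (le_max_left _ _)) (abs_nonneg _)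

lemma ibp {D : Set (Ed d)} (hD : IsCompact D) {F : Ed d → Ed d} (hF : ContDiff ℝ 1 F)
    (hFD : tsupport F ⊆ D) : ∃ C : ℝ, 0 ≤ C ∧ ∀ f : Ed d → ℝ, ContDiff ℝ 1 f →
      |∫ x in D, ⟪F x, gradient f x⟫| ≤ C * ∫ x in D, |f x| := by
  set b := EuclideanSpace.basisFun (Fin d) ℝ with hb
  have ha : ∀ i, ContDiff ℝ 1 (fun x => ⟪F x, b i⟫) := fun i => hF.inner ℝ contDiff_const
  have hs : ∀ i, tsupport (fun x => ⟪F x, b i⟫) ⊆ D := by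
    intro i
    have : Function.support (fun x => ⟪F x, b i⟫) ⊆ Function.support F := fun x hx h =>
      hx (by show ⟪F x, b i⟫ = 0; rw [h, inner_zero_left])
    exact (closure_mono this).trans hFD
  choose C hC0 hC using fun i => ibp1 hD (ha i) (hs i) (b i)
  refine ⟨∑ i, C i, Finset.sum_nonneg fun i _ => hC0 i, fun f hf => ?_⟩
  have e1 : ∫ x in D, ⟪F x, gradient f x⟫ =
      ∑ i, ∫ x in D, ⟪F x, b i⟫ * ⟪gradient f x, b i⟫ := by
    rw [← integral_finsetSum]
    · congr 1; ext x
      rw [← b.sum_inner_mul_inner]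
      exact Finset.sum_congr rfl fun i _ => by rw [real_inner_comm (gradient f x)]
    · intro i _
      exact ((ha i).continuous.mul ((cont_gradient hf).inner
        continuous_const)).continuousOn.integrableOn_compact hD
  rw [e1, Finset.sum_mul]
  exact (Finset.abs_sum_le_sum_abs _ _).trans (Finset.sum_le_sum fun i _ => hC i f hf)

lemma weak_conv {D : Set (Ed d)} (hD : IsCompact D) {η : Ed d → ℝ} (hη : ContDiff ℝ 1 η)
    (hηD : tsupport η ⊆ D) (hη0 : ∀ x, 0 ≤ η x) {H : Ed d → Ed d} (hH : Continuous H)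
    {f : ℕ → Ed d → ℝ} (hf : ∀ n, ContDiff ℝ 1 (f n)) {B : ℝ}
    (hB : ∀ᶠ n in atTop, ∫ x in D, η x * ‖gradient (f n) x‖ ≤ B)
    (h0 : Tendsto (fun n => ∫ x in D, |f n x|) atTop (𝓝 0)) :
    Tendsto (fun n => ∫ x in D, η x * ⟪H x, gradient (f n) x⟫) atTop (𝓝 0) := by
  rw [Metric.tendsto_atTop]
  intro ε hε
  set δ := ε / (2 * (|B| + 1)) with hδ
  have hδ0 : 0 < δ := by positivity
  obtain ⟨G, hG1, hG2, -⟩ := hH.exists_contDiff_approx 1 (ε := fun _ => δ) continuous_const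
    (fun _ => hδ0)
  have hG1' : ContDiff ℝ 1 G := by exact_mod_cast hG1
  have hFs : tsupport (fun x => η x • G x) ⊆ D := by
    have : Function.support (fun x => η x • G x) ⊆ Function.support η := fun x hx h =>
      hx (by show η x • G x = 0; rw [h, zero_smul])
    exact (closure_mono this).trans hηD
  obtain ⟨C, hC0, hC⟩ := ibp hD (hη.smul hG1') hFs
  have hlim : Tendsto (fun n => C * ∫ x in D, |f n x|) atTop (𝓝 0) := by
    simpa using h0.const_mul C
  obtain ⟨N, hN⟩ := eventually_atTop.1 (hB.and (hlim.eventually_lt_const (half_pos hε)))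
  refine ⟨N, fun n hn => ?_⟩
  obtain ⟨b1, b2⟩ := hN n hn
  have cg := cont_gradient (hf n)
  have i1 : IntegrableOn (fun x => ⟪η x • G x, gradient (f n) x⟫) D :=
    ((hη.continuous.smul hG1'.continuous).inner cg).continuousOn.integrableOn_compact hD
  have i2 : IntegrableOn (fun x => η x * ⟪H x, gradient (f n) x⟫) D :=
    (hη.continuous.mul (hH.inner cg)).continuousOn.integrableOn_compact hD
  have i3 : IntegrableOn (fun x => δ * (η x * ‖gradient (f n) x‖)) D :=
    ((hη.continuous.mul cg.norm).continuousOn.integrableOn_compact hD).const_mul _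
  rw [Real.dist_eq, sub_zero]
  have e1 : |(∫ x in D, η x * ⟪H x, gradient (f n) x⟫) - ∫ x in D, ⟪η x • G x, gradient (f n) x⟫|
      ≤ δ * ∫ x in D, η x * ‖gradient (f n) x‖ := by
    rw [← integral_sub i2 i1, ← integral_const_mul]
    refine abs_integral_le_integral_abs.trans ?_
    refine integral_mono (i2.sub i1).abs i3 fun x => ?_
    simp only []
    rw [real_inner_smul_left, ← mul_sub, ← inner_sub_left, abs_mul, abs_of_nonneg (hη0 x)]
    have := (abs_real_inner_le_norm (H x - G x) (gradient (f n) x))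
    have h2 : ‖H x - G x‖ ≤ δ := by
      rw [← dist_eq_norm, dist_comm]; exact (hG2 x).le
    calc _ ≤ η x * (‖H x - G x‖ * ‖gradient (f n) x‖) := mul_le_mul_of_nonneg_left this (hη0 x)
      _ ≤ η x * (δ * ‖gradient (f n) x‖) := by
        refine mul_le_mul_of_nonneg_left ?_ (hη0 x)
        gcongr
      _ = _ := by ring
  have e2 : |∫ x in D, ⟪η x • G x, gradient (f n) x⟫| ≤ C * ∫ x in D, |f n x| := hC (f n) (hf n)
  have e3 : δ * (∫ x in D, η x * ‖gradient (f n) x‖) ≤ δ * |B| :=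
    mul_le_mul_of_nonneg_left (b1.trans (le_abs_self _)) hδ0.le
  have e4 : δ * |B| < ε / 2 := by
    have : δ * |B| = ε / 2 * (|B| / (|B| + 1)) := by rw [hδ]; field_simp
    rw [this]
    have : |B| / (|B| + 1) < 1 := by rw [div_lt_one (by positivity)]; linarith
    nlinarith
  have := abs_sub_abs_le_abs_sub (∫ x in D, η x * ⟪H x, gradient (f n) x⟫)
    (∫ x in D, ⟪η x • G x, gradient (f n) x⟫)
  linarith
end Part6

section Part7
variable {d : ℕ}

lemma master_ev {p : ℝ} (hp : 1 < p) {Ω : Set (Ed d)} {V : Ed d → ℝ} (ho : IsOpen Ω)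
    (hV : LocBddOn Ω V) (hnn : NonnegOn p Ω V) {m : ℕ} (hm2 : 2 ≤ m) (hmp : p ≤ m) {χ : Ed d → ℝ}
    (hχ : IsTestOn Ω χ) (hχ01 : ∀ x, 0 ≤ χ x ∧ χ x ≤ 1)
    {Φ h : Ed d → ℝ} (hΦ : ContDiff ℝ 1 Φ) (hh : ContDiff ℝ 1 h)
    {U : Set (Ed d)} (hU : IsOpen U) (hhU : tsupport h ⊆ U) (hχU : ∀ x ∈ U, χ x = 1)
    {u : ℕ → Ed d → ℝ} (hu : ∀ n, IsTestOn Ω (u n))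
    (hQ : Tendsto (fun n => Qp p Ω V (u n)) atTop (𝓝 0))
    (hc : Tendsto (fun n => ∫ x in tsupport χ, |u n x - Φ x| ^ p) atTop (𝓝 0))
    {ε : ℝ} (hε : 0 < ε) : ∃ R : ℕ → ℝ,
    (∀ n, ∫ x in tsupport χ, χ x ^ m * ‖gradient (u n) x‖ ^ p ≤ R n) ∧ Tendsto R atTop (𝓝 (
      (1 + ε) * (∫ x in tsupport χ, χ x ^ m * ‖gradient (fun y => Φ y + h y) x‖ ^ p)
      + ((∫ x in tsupport χ, V x * |Φ x + h x| ^ p) - ∫ x in tsupport χ, V x * |Φ x| ^ p))) := by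
  have hp0 : 0 < p := by linarith
  obtain ⟨C, hC⟩ := master hp ho hV hnn hm2 hmp hχ hχ01 hΦ hh hU hhU hχU hε
  refine ⟨_, fun n => hC (u n) (hu n), ?_⟩
  set D := tsupport χ with hD
  have hDc : IsCompact D := hχ.2.1
  have hχ1 := hχ.c1c.1
  have t1 := lp_conv hp hV hDc hχ.2.2 (fun n => (hu n).1.continuous.continuousOn)
    hΦ.continuous.continuousOn hc
  have t2 : Tendsto (fun n => ∫ x in D, V x * |u n x + χ x ^ m * (Φ x + h x - u n x)| ^ p) atTop
      (𝓝 (∫ x in D, V x * |Φ x + h x| ^ p)) := by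
    have cv : ∀ n, Continuous (fun x => u n x + χ x ^ m * (Φ x + h x - u n x)) := fun n =>
      (hu n).1.continuous.add ((hχ1.continuous.pow m).mul
        ((hΦ.continuous.add hh.continuous).sub (hu n).1.continuous))
    refine lp_conv hp hV hDc hχ.2.2 (fun n => (cv n).continuousOn)
      (hΦ.continuous.add hh.continuous).continuousOn ?_
    refine squeeze_zero (fun n => integral_nonneg fun x => by positivity) (fun n => ?_) hc
    refine integral_mono_of_nonneg (Eventually.of_forall fun x => by positivity)
      ((cont_pow hp ((hu n).1.continuous.sub hΦ.continuous).continuousOn).integrableOn_compact hDc)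
      (Eventually.of_forall fun x => ?_)
    have hz : (1 - χ x ^ m) * h x = 0 := by
      by_cases hx : x ∈ tsupport h
      · rw [hχU x (hhU hx)]; simp
      · rw [zero_out hx, mul_zero]
    have e : u n x + χ x ^ m * (Φ x + h x - u n x) - (Φ x + h x) =
        (1 - χ x ^ m) * (u n x - Φ x) := by linear_combination -hz
    simp only []
    rw [e, abs_mul]
    have h0 : 0 ≤ χ x ^ m := pow_nonneg (hχ01 x).1 _
    have h1 : χ x ^ m ≤ 1 := pow_le_one₀ (hχ01 x).1 (hχ01 x).2
    refine Real.rpow_le_rpow (by positivity) ?_ hp0.le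
    have : |1 - χ x ^ m| ≤ 1 := abs_le.2 ⟨by linarith, by linarith⟩
    exact mul_le_of_le_one_left (abs_nonneg _) this
  have := ((hQ.add (tendsto_const_nhds (x := (1 + ε) * (∫ x in D, χ x ^ m *
    ‖gradient (fun y => Φ y + h y) x‖ ^ p)))).add (hc.const_mul C)).add (t2.sub t1)
  convert this using 2
  ring

lemma l1_conv {p : ℝ} (hp : 1 < p) {D : Set (Ed d)} (hD : IsCompact D) {f : ℕ → Ed d → ℝ}
    (hf : ∀ n, ContinuousOn (f n) D)
    (h : Tendsto (fun n => ∫ x in D, |f n x| ^ p) atTop (𝓝 0)) :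
    Tendsto (fun n => ∫ x in D, |f n x|) atTop (𝓝 0) := by
  have hp0 : 0 < p := by linarith
  have h1 : Tendsto (fun n => (volume.real D ^ (p - 1) * ∫ x in D, |f n x| ^ p) ^ (p⁻¹)) atTop
      (𝓝 0) := by
    have := (h.const_mul (volume.real D ^ (p - 1))).rpow_const (p := p⁻¹)
      (Or.inr (inv_nonneg.2 hp0.le))
    simpa [Real.zero_rpow (inv_ne_zero hp0.ne')] using this
  refine squeeze_zero (fun n => integral_nonneg fun x => abs_nonneg _) (fun n => ?_) h1
  have hn : 0 ≤ ∫ x in D, |f n x| := integral_nonneg fun x => abs_nonneg _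
  calc _ = ((∫ x in D, |f n x|) ^ p) ^ (p⁻¹) := (Real.rpow_rpow_inv hn hp0.ne').symm
    _ ≤ _ := Real.rpow_le_rpow (by positivity) (jensen_compact hp hD (hf n)) (by positivity)

lemma energy {p : ℝ} (hp : 1 < p) {Ω : Set (Ed d)} {V : Ed d → ℝ} (ho : IsOpen Ω)
    (hV : LocBddOn Ω V) (hnn : NonnegOn p Ω V) {m : ℕ} (hm2 : 2 ≤ m) (hmp : p ≤ m) {χ : Ed d → ℝ}
    (hχ : IsTestOn Ω χ) (hχ01 : ∀ x, 0 ≤ χ x ∧ χ x ≤ 1)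
    {Φ h : Ed d → ℝ} (hΦ : ContDiff ℝ 1 Φ) (hh : ContDiff ℝ 1 h)
    {U : Set (Ed d)} (hU : IsOpen U) (hhU : tsupport h ⊆ U) (hχU : ∀ x ∈ U, χ x = 1)
    {u : ℕ → Ed d → ℝ} (hu : ∀ n, IsTestOn Ω (u n))
    (hQ : Tendsto (fun n => Qp p Ω V (u n)) atTop (𝓝 0))
    (hc : Tendsto (fun n => ∫ x in tsupport χ, |u n x - Φ x| ^ p) atTop (𝓝 0)) :
    (∫ x in tsupport χ, χ x ^ m * ‖gradient Φ x‖ ^ p) + (∫ x in tsupport χ, V x * |Φ x| ^ p) ≤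
    (∫ x in tsupport χ, χ x ^ m * ‖gradient (fun y => Φ y + h y) x‖ ^ p)
      + ∫ x in tsupport χ, V x * |Φ x + h x| ^ p := by
  have hp0 : 0 < p := by linarith
  set D := tsupport χ with hD
  have hDc : IsCompact D := hχ.2.1
  have hχ1 := hχ.c1c.1
  have hη : ContDiff ℝ 1 (fun x => χ x ^ m) := hχ1.pow m
  have hη0 : ∀ x, 0 ≤ χ x ^ m := fun x => pow_nonneg (hχ01 x).1 _
  have hηD : tsupport (fun x => χ x ^ m) ⊆ D := by
    have : Function.support (fun x => χ x ^ m) ⊆ Function.support χ := fun x hx h =>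
      hx (by show χ x ^ m = 0; rw [h, zero_pow (by omega)])
    exact closure_mono this
  have iηG : ∀ w : Ed d → ℝ, ContDiff ℝ 1 w → 
      IntegrableOn (fun x => χ x ^ m * ‖gradient w x‖ ^ p) D := fun w hw =>
    ((hχ1.continuous.pow m).mul (cont_normgrad hw hp)).continuousOn.integrableOn_compact hDc
  -- bound
  obtain ⟨R₀, hR₀, hR₀t⟩ := master_ev hp ho hV hnn hm2 hmp hχ hχ01 hΦ (h := fun _ => 0)
    contDiff_const hU (by simp [tsupport]) hχU hu hQ hc one_pos
  obtain ⟨B₀, hB₀⟩ := hR₀t.bddAbove_range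
  have hEb : ∀ n, ∫ x in D, χ x ^ m * ‖gradient (u n) x‖ ^ p ≤ B₀ := fun n =>
    (hR₀ n).trans (hB₀ (Set.mem_range_self n))
  have hf1 : ∀ n, ContDiff ℝ 1 (fun x => u n x - Φ x) := fun n => (hu n).c1c.1.sub hΦ
  have iη : IntegrableOn (fun x => 2 * χ x ^ m) D :=
    (hη.continuous.continuousOn.integrableOn_compact hDc).const_mul 2
  have hle : ∀ t : ℝ, 0 ≤ t → t ≤ 1 + t ^ p := fun t ht => by
    rcases le_total t 1 with h | h
    · linarith [Real.rpow_nonneg ht p]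
    · linarith [Real.self_le_rpow_of_one_le h hp.le]
  have hB : ∀ n, ∫ x in D, χ x ^ m * ‖gradient (fun x => u n x - Φ x) x‖ ≤
      (∫ x in D, 2 * χ x ^ m) + (B₀ + ∫ x in D, χ x ^ m * ‖gradient Φ x‖ ^ p) := by
    intro n
    have i0 := iηG _ (hu n).c1c.1
    have i1 : IntegrableOn (fun x => χ x ^ m * ‖gradient (u n) x‖ ^ p
      + χ x ^ m * ‖gradient Φ x‖ ^ p) D := i0.add (iηG _ hΦ)
    calc _ ≤ ∫ x in D, (2 * χ x ^ m + (χ x ^ m * ‖gradient (u n) x‖ ^ p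
          + χ x ^ m * ‖gradient Φ x‖ ^ p)) := by
          refine integral_mono ((hη.continuous.mul
            (cont_gradient (hf1 n)).norm).continuousOn.integrableOn_compact hDc)
            (iη.add i1) fun x => ?_
          simp only []
          rw [grad_sub (C1.diff (hu n).c1c.1 x) (C1.diff hΦ x)]
          have a1 := norm_sub_le (gradient (u n) x) (gradient Φ x)
          have a2 := hle _ (norm_nonneg (gradient (u n) x))
          have a3 := hle _ (norm_nonneg (gradient Φ x))
          have := mul_le_mul_of_nonneg_left (a1.trans (add_le_add a2 a3)) (hη0 x)
          linarith
      _ = (∫ x in D, 2 * χ x ^ m) + ((∫ x in D, χ x ^ m * ‖gradient (u n) x‖ ^ p)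
          + ∫ x in D, χ x ^ m * ‖gradient Φ x‖ ^ p) := by
          rw [integral_add iη i1, integral_add i0 (iηG _ hΦ)]
      _ ≤ _ := by linarith [hEb n]
  have hl1 := l1_conv hp hDc (fun n => (hf1 n).continuous.continuousOn) hc
  have hH : Continuous (fun x => NG p (gradient Φ x)) :=
    (NG_continuous hp).comp (cont_gradient hΦ)
  have hweak := weak_conv hDc hη hηD hη0 hH hf1 (Eventually.of_forall hB) hl1
  have hlsc : ∀ n, (∫ x in D, χ x ^ m * ‖gradient Φ x‖ ^ p) +
      (∫ x in D, χ x ^ m * ⟪NG p (gradient Φ x), gradient (fun x => u n x - Φ x) x⟫) ≤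
      ∫ x in D, χ x ^ m * ‖gradient (u n) x‖ ^ p := by
    intro n
    have i2 : IntegrableOn (fun x => χ x ^ m *
        ⟪NG p (gradient Φ x), gradient (fun x => u n x - Φ x) x⟫) D :=
      (hη.continuous.mul (hH.inner (cont_gradient (hf1 n)))).continuousOn.integrableOn_compact hDc
    rw [← integral_add (iηG _ hΦ) i2]
    refine integral_mono ((iηG _ hΦ).add i2) (iηG _ (hu n).c1c.1) fun x => ?_
    simp only []
    rw [grad_sub (C1.diff (hu n).c1c.1 x) (C1.diff hΦ x), ← mul_add]
    refine mul_le_mul_of_nonneg_left ?_ (hη0 x)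
    have := LL_nonneg hp (gradient Φ x) (gradient (u n) x - gradient Φ x)
    rw [LL, add_sub_cancel] at this
    linarith
  set A := ∫ x in D, χ x ^ m * ‖gradient (fun y => Φ y + h y) x‖ ^ p with hA
  set S := (∫ x in D, V x * |Φ x + h x| ^ p) - ∫ x in D, V x * |Φ x| ^ p with hS
  set T := ∫ x in D, χ x ^ m * ‖gradient Φ x‖ ^ p with hT
  have hfin : ∀ ε : ℝ, 0 < ε → T ≤ (1 + ε) * A + S := by
    intro ε hε
    obtain ⟨R, hR, hRt⟩ := master_ev hp ho hV hnn hm2 hmp hχ hχ01 hΦ hh hU hhU hχU hu hQ hc hε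
    have := le_of_tendsto_of_tendsto' (hweak.const_add T) hRt (fun n => (hlsc n).trans (hR n))
    simpa using this
  have : T ≤ A + S := by
    have hl : Tendsto (fun ε : ℝ => (1 + ε) * A + S) (𝓝[>] 0) (𝓝 ((1 + 0) * A + S)) := by
      have : Continuous (fun ε : ℝ => (1 + ε) * A + S) := by fun_prop
      exact (this.tendsto 0).mono_left nhdsWithin_le_nhds
    have := ge_of_tendsto hl (eventually_mem_nhdsWithin.mono fun ε hε => hfin ε hε)
    simpa using this
  rw [hS] at this
  linarith
end Part7

section Part8
variable {d : ℕ}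

lemma deriv_int {D : Set (Ed d)} (hD : IsCompact D) {c : Ed d → ℝ} (hcm : AEStronglyMeasurable c)
    (hc : IntegrableOn c D) {g g' : ℝ → Ed d → ℝ} (hg : ∀ t, Continuous (g t))
    (hg' : Continuous (fun z : ℝ × Ed d => g' z.1 z.2))
    (hd : ∀ t x, HasDerivAt (fun s => g s x) (g' t x) t) (hc0 : IntegrableOn (fun x => c x * g 0 x) D) :
    HasDerivAt (fun t => ∫ x in D, c x * g t x) (∫ x in D, c x * g' 0 x) 0 := by
  obtain ⟨M, hM⟩ := ((isCompact_Icc (a := (-1:ℝ)) (b := 1)).prod hD).exists_bound_of_continuousOn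
    hg'.continuousOn
  refine (hasDerivAt_integral_of_dominated_loc_of_deriv_le (μ := volume.restrict D)
    (F := fun t x => c x * g t x) (F' := fun t x => c x * g' t x) (x₀ := 0)
    (bound := fun x => |c x| * M) (s := Metric.ball 0 1) (Metric.ball_mem_nhds _ one_pos)
    ?_ hc0 ?_ ?_ ?_ ?_).2
  · exact Eventually.of_forall fun t => hcm.restrict.mul (hg t).aestronglyMeasurable
  · exact hcm.restrict.mul (hg'.comp (Continuous.prodMk_right (0:ℝ))).aestronglyMeasurable
  · filter_upwards [ae_restrict_mem hD.measurableSet] with x hx t ht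
    rw [norm_mul, Real.norm_eq_abs]
    refine mul_le_mul_of_nonneg_left (hM (t, x) ⟨?_, hx⟩) (abs_nonneg _)
    rw [Metric.mem_ball, dist_zero_right, Real.norm_eq_abs] at ht
    exact ⟨by linarith [(abs_lt.1 ht).1], (abs_lt.1 ht).2.le⟩
  · exact hc.abs.mul_const M
  · exact Eventually.of_forall fun x t _ => (hd t x).const_mul _

lemma euler {p : ℝ} (hp : 1 < p) {Ω : Set (Ed d)} {V : Ed d → ℝ} (ho : IsOpen Ω)
    (hV : LocBddOn Ω V) (hnn : NonnegOn p Ω V) {m : ℕ} (hm2 : 2 ≤ m) (hmp : p ≤ m) {χ : Ed d → ℝ}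
    (hχ : IsTestOn Ω χ) (hχ01 : ∀ x, 0 ≤ χ x ∧ χ x ≤ 1)
    {Φ h : Ed d → ℝ} (hΦ : ContDiff ℝ 1 Φ) (hh : ContDiff ℝ 1 h)
    {U : Set (Ed d)} (hU : IsOpen U) (hhU : tsupport h ⊆ U) (hχU : ∀ x ∈ U, χ x = 1)
    {u : ℕ → Ed d → ℝ} (hu : ∀ n, IsTestOn Ω (u n))
    (hQ : Tendsto (fun n => Qp p Ω V (u n)) atTop (𝓝 0))
    (hc : Tendsto (fun n => ∫ x in tsupport χ, |u n x - Φ x| ^ p) atTop (𝓝 0)) :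
    (∫ x in tsupport χ, 1 * (χ x ^ m * ⟪NG p (gradient Φ x), gradient h x⟫))
      + (∫ x in tsupport χ, V x * (deriv (fun s : ℝ => |s| ^ p) (Φ x) * h x)) = 0 := by
  have hp0 : 0 < p := by linarith
  set D := tsupport χ with hD
  have hDc : IsCompact D := hχ.2.1
  have hχ1 := hχ.c1c.1
  have hE : ∀ t : ℝ, (∫ x in D, χ x ^ m * ‖gradient Φ x‖ ^ p) + (∫ x in D, V x * |Φ x| ^ p) ≤
    (∫ x in D, χ x ^ m * ‖gradient Φ x + t • gradient h x‖ ^ p)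
      + ∫ x in D, V x * |Φ x + t * h x| ^ p := by
    intro t
    have hth : ContDiff ℝ 1 (fun x => t * h x) := contDiff_const.mul hh
    have hs : tsupport (fun x => t * h x) ⊆ U := by
      have : Function.support (fun x => t * h x) ⊆ Function.support h := fun x hx h0 =>
        hx (by show t * h x = 0; rw [h0, mul_zero])
      exact (closure_mono this).trans hhU
    have := energy hp ho hV hnn hm2 hmp hχ hχ01 hΦ hth hU hs hχU hu hQ hc
    have e : ∀ x, gradient (fun y => Φ y + t * h y) x = gradient Φ x + t • gradient h x := by
      intro x
      rw [grad_add (C1.diff hΦ x) (C1.diff hth x),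
        grad_comp (q := fun s => t * s) (q' := t) (by simpa using (hasDerivAt_id (h x)).const_mul t)
          (C1.diff hh x)]
    simp_rw [e] at this
    exact this
  have cΦ := cont_gradient hΦ
  have ch := cont_gradient hh
  have hcd : ContDiff ℝ 1 (fun s : ℝ => |s| ^ p) := by
    simpa [Real.norm_eq_abs] using (contDiff_norm_rpow (E := ℝ) hp)
  have d1 := deriv_int hDc (c := fun _ => (1:ℝ)) aestronglyMeasurable_const
    (integrableOn_const hDc.measure_lt_top.ne)
    (g := fun t x => χ x ^ m * ‖gradient Φ x + t • gradient h x‖ ^ p)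
    (g' := fun t x => χ x ^ m * ⟪NG p (gradient Φ x + t • gradient h x), gradient h x⟫)
    (fun t => (hχ1.continuous.pow m).mul ((cΦ.add (ch.const_smul t)).norm.rpow_const
      (fun _ => Or.inr hp0.le)))
    (((hχ1.continuous.comp continuous_snd).pow m).mul
      (((NG_continuous hp).comp ((cΦ.comp continuous_snd).add
        (continuous_fst.smul (ch.comp continuous_snd)))).inner (ch.comp continuous_snd)))
    (fun t x => by
      have h1 : HasDerivAt (fun s : ℝ => gradient Φ x + s • gradient h x) (gradient h x) t := by
        simpa using ((hasDerivAt_id t).smul_const (gradient h x)).const_add (gradient Φ x)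
      have h2 := (NG_hasFDerivAt hp (gradient Φ x + t • gradient h x)).comp_hasDerivAt t h1
      exact (h2.const_mul (χ x ^ m)))
    (by
      refine (Continuous.continuousOn ?_).integrableOn_compact hDc
      exact continuous_const.mul ((hχ1.continuous.pow m).mul
        ((cΦ.add (ch.const_smul (0:ℝ))).norm.rpow_const (fun _ => Or.inr hp0.le))))
  have hVi : IntegrableOn V D := by
    simpa using intV hV hDc hχ.2.2 (integrableOn_const (C := (1:ℝ)) hDc.measure_lt_top.ne)
  have d2 := deriv_int hDc (c := V) hV.1.aestronglyMeasurable hVi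
    (g := fun t x => |Φ x + t * h x| ^ p)
    (g' := fun t x => deriv (fun s : ℝ => |s| ^ p) (Φ x + t * h x) * h x)
    (fun t => ((hΦ.continuous.add (continuous_const.mul hh.continuous)).abs.rpow_const
      (fun _ => Or.inr hp0.le)))
    (((hcd.continuous_deriv le_rfl).comp ((hΦ.continuous.comp continuous_snd).add
        (continuous_fst.mul (hh.continuous.comp continuous_snd)))).mul
        (hh.continuous.comp continuous_snd))
    (fun t x => by
      have h1 : HasDerivAt (fun s : ℝ => Φ x + s * h x) (h x) t := by
        simpa using ((hasDerivAt_id t).mul_const (h x)).const_add (Φ x)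
      have h2 := ((hcd.differentiable one_ne_zero) (Φ x + t * h x)).hasDerivAt
      exact HasDerivAt.comp t h2 h1)
    (intV hV hDc hχ.2.2 ((cont_pow hp (hΦ.continuous.add
      (continuous_const.mul hh.continuous)).continuousOn).integrableOn_compact hDc))
  have dd := d1.add d2
  have hmin : IsLocalMin ((fun t : ℝ => ∫ x in D, 1 * (χ x ^ m *
      ‖gradient Φ x + t • gradient h x‖ ^ p)) + fun t : ℝ => ∫ x in D, V x * |Φ x + t * h x| ^ p)
      0 := by
    refine Eventually.of_forall fun t => ?_
    simpa using hE t
  have := hmin.hasDerivAt_eq_zero dd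
  simpa using this

lemma C1c_mul {Ω : Set (Ed d)} (ho : IsOpen Ω) {η f : Ed d → ℝ} (hη : C1c Ω η)
    (hf : ContDiffOn ℝ 1 f Ω) : C1c Ω (fun x => η x * f x) := by
  have hs : tsupport (fun x => η x * f x) ⊆ tsupport η := by
    have : Function.support (fun x => η x * f x) ⊆ Function.support η := fun x hx h0 =>
      hx (by show η x * f x = 0; rw [h0, zero_mul])
    exact closure_mono this
  refine ⟨contDiff_iff_contDiffAt.2 fun x => ?_,
    IsCompact.of_isClosed_subset hη.2.1 (isClosed_tsupport _) hs, hs.trans hη.2.2⟩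
  by_cases hx : x ∈ Ω
  · exact hη.1.contDiffAt.mul (hf.contDiffAt (ho.mem_nhds hx))
  · have : (fun x => η x * f x) =ᶠ[𝓝 x] fun _ => 0 := by
      filter_upwards [notMem_tsupport_iff_eventuallyEq.1 (fun h => hx (hη.2.2 h))] with y hy
      rw [hy]; simp
    exact contDiffAt_const.congr_of_eventuallyEq this

lemma weak_eq {p : ℝ} (hp : 1 < p) {Ω : Set (Ed d)} {V φ : Ed d → ℝ} (ho : IsOpen Ω)
    (hV : LocBddOn Ω V) (hnn : NonnegOn p Ω V) (hgs : IsGroundStateOn p Ω V φ)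
    {S : Set (Ed d)} (hS : IsCompact S) (hSΩ : S ⊆ Ω) {h : Ed d → ℝ} (hh : ContDiff ℝ 1 h)
    (hhS : tsupport h ⊆ S) :
    (∫ x in S, ⟪NG p (gradient φ x), gradient h x⟫)
      + (∫ x in S, V x * (p * φ x ^ (p - 1) * h x)) = 0 := by
  obtain ⟨hφ1, hφ0, u, ⟨hu, -, -, hQ⟩, hconv⟩ := hgs
  obtain ⟨χ, hχ, hχ01, U, hU, hSU, hχU⟩ := cutoff ho hS hSΩ
  obtain ⟨κ, hκ, hκ01, U', hU', hDU', hκU'⟩ := cutoff ho hχ.2.1 hχ.2.2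
  have hSD : S ⊆ tsupport χ := fun x hx => subset_tsupport _ (by
    rw [Function.mem_support, hχU x (hSU hx)]; exact one_ne_zero)
  have hΦ := (C1c_mul ho hκ.c1c hφ1).1
  set Φ := fun x => κ x * φ x with hΦd
  have hΦe : ∀ x ∈ tsupport χ, Φ =ᶠ[𝓝 x] φ := fun x hx => by
    filter_upwards [hU'.mem_nhds (hDU' hx)] with y hy
    rw [hΦd]; beta_reduce; rw [hκU' y hy, one_mul]
  have hΦx : ∀ x ∈ tsupport χ, Φ x = φ x := fun x hx => (hΦe x hx).self_of_nhds
  have hDm : MeasurableSet (tsupport χ) := (isClosed_tsupport χ).measurableSet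
  obtain ⟨m, hm⟩ := exists_nat_ge (max p 2)
  have hm2 : 2 ≤ m := by exact_mod_cast (le_max_right p 2).trans hm
  have hc : Tendsto (fun n => ∫ x in tsupport χ, |u n x - Φ x| ^ p) atTop (𝓝 0) := by
    refine (hconv _ hχ.2.1 hχ.2.2).congr fun n => ?_
    exact setIntegral_congr_fun hDm fun x hx => by beta_reduce; rw [hΦx x hx]
  have key := euler hp ho hV hnn hm2 ((le_max_left _ _).trans hm) hχ hχ01 hΦ hh hU
    (hhS.trans hSU) hχU hu hQ hc
  rw [← key]
  congr 1
  · rw [setIntegral_eq_of_subset_of_forall_sdiff_eq_zero hDm hSD]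
    · refine setIntegral_congr_fun hS.measurableSet fun x hx => ?_
      beta_reduce
      rw [hχU x (hSU hx), grad_congr (hΦe x (hSD hx))]; simp
    · intro x hx
      rw [grad_zero (fun h => hx.2 (hhS h)), inner_zero_right]; simp
  · rw [setIntegral_eq_of_subset_of_forall_sdiff_eq_zero hDm hSD]
    · refine setIntegral_congr_fun hS.measurableSet fun x hx => ?_
      beta_reduce
      rw [hΦx x (hSD hx)]
      have hpos := hφ0 x (hSΩ hx)
      have : deriv (fun s : ℝ => |s| ^ p) (φ x) = p * φ x ^ (p - 1) := by
        have e : (fun s : ℝ => |s| ^ p) =ᶠ[𝓝 (φ x)] fun s => s ^ p := by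
          filter_upwards [lt_mem_nhds hpos] with s hs
          rw [abs_of_pos hs]
        rw [e.deriv_eq]
        exact (Real.hasDerivAt_rpow_const (Or.inl hpos.ne')).deriv
      rw [this]
    · intro x hx
      rw [zero_out (fun h => hx.2 (hhS h))]; simp
end Part8

section Part9
variable {d : ℕ}

lemma abs_sq_mul {p : ℝ} (hp : 1 < p) (w : ℝ) : |w| ^ (p - 2) * (w * w) = |w| ^ p := by
  by_cases h : w = 0
  · subst h; simp [Real.zero_rpow (by linarith : p ≠ 0)]
  · have : 0 < |w| := abs_pos.2 h
    rw [← abs_mul_abs_self w, ← sq, ← Real.rpow_natCast, ← Real.rpow_add this]; norm_num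

lemma LL_contOn {p : ℝ} (hp : 1 < p) {a b : Ed d → Ed d} {S : Set (Ed d)}
    (ha : ContinuousOn a S) (hb : ContinuousOn b S) :
    ContinuousOn (fun x => LL p (a x) (b x)) S := by
  have h1 : ContinuousOn (fun x => (a x, b x)) S := ha.prodMk hb
  have h2 := (LL_continuous (d := d) hp).comp_continuousOn h1
  have h3 : ((fun x : Ed d × Ed d => LL p x.1 x.2) ∘ fun x => (a x, b x))
    = fun x => LL p (a x) (b x) := by
      funext x
      simp only [Function.comp_apply]
  rwa [h3] at h2

lemma picone_pt {p : ℝ} (hp : 1 < p) (g U : Ed d) {f : ℝ} (hf : 0 < f) (s : ℝ) :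
    ‖U‖ ^ p = LL p ((s / f) • g) (U - (s / f) • g) + (1 / p) *
      ⟪NG p g, |s| ^ p • (((1 - p) * f ^ (-p)) • g) + f ^ (1 - p) • ((p * |s| ^ (p - 2) * s) • U)⟫ := by
  have hp0 : 0 < p := by linarith
  have hw : |s / f| ^ (p - 2) * (s / f) = f ^ (1 - p) * (|s| ^ (p - 2) * s) := by
    rw [abs_div, abs_of_pos hf, Real.div_rpow (abs_nonneg _) hf.le,
      show 1 - p = -(p - 2) - 1 by ring, Real.rpow_sub_one hf.ne', Real.rpow_neg hf.le]
    field_simp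
  have hw2 : |s / f| ^ p = |s| ^ p * f ^ (-p) := by
    rw [abs_div, abs_of_pos hf, Real.div_rpow (abs_nonneg _) hf.le, Real.rpow_neg hf.le]
    field_simp
  have hw3 := abs_sq_mul hp (s / f)
  have hg := abs_sq_mul hp ‖g‖
  rw [abs_of_nonneg (norm_nonneg g)] at hg
  generalize s / f = w at *
  have e1 : ‖w • g‖ ^ p = |w| ^ p * ‖g‖ ^ p := by
    rw [norm_smul, Real.norm_eq_abs, Real.mul_rpow (abs_nonneg _) (norm_nonneg _)]
  have e2 : ‖w • g‖ ^ (p - 2) = |w| ^ (p - 2) * ‖g‖ ^ (p - 2) := by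
    rw [norm_smul, Real.norm_eq_abs, Real.mul_rpow (abs_nonneg _) (norm_nonneg _)]
  unfold LL NG
  rw [add_sub_cancel, e1, e2]
  simp only [inner_add_right, inner_sub_right, inner_smul_right, real_inner_smul_left,
    real_inner_self_eq_norm_mul_norm]
  have e3 : |s| ^ p * ((1 - p) * f ^ (-p) * (p * ‖g‖ ^ (p - 2) * (‖g‖ * ‖g‖)))
      = p * ((1 - p) * (|w| ^ p * ‖g‖ ^ p)) := by rw [hw2, ← hg]; ring
  have e4 : ∀ I : ℝ, f ^ (1 - p) * (p * |s| ^ (p - 2) * s * (p * ‖g‖ ^ (p - 2) * I))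
      = p * (p * (|w| ^ (p - 2) * w) * ‖g‖ ^ (p - 2) * I) := by intro I; rw [hw]; ring
  rw [e3, e4]
  have e5 : p * (|w| ^ (p - 2) * ‖g‖ ^ (p - 2)) * (w * (w * (‖g‖ * ‖g‖))) =
      p * (|w| ^ p * ‖g‖ ^ p) := by rw [← hw3, ← hg]; ring
  field_simp
  linear_combination (-1:ℝ) * e5

set_option maxHeartbeats 1000000 in
lemma picone {p : ℝ} (hp : 1 < p) {Ω : Set (Ed d)} {V φ : Ed d → ℝ} (ho : IsOpen Ω)
    (hV : LocBddOn Ω V) (hnn : NonnegOn p Ω V) (hgs : IsGroundStateOn p Ω V φ)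
    {S : Set (Ed d)} (hS : IsCompact S) (hSΩ : S ⊆ Ω) {u : Ed d → ℝ} (hu : IsTestOn Ω u)
    (huS : tsupport u ⊆ S) :
    ∃ w : Ed d → ℝ, ContDiff ℝ 1 w ∧ (∀ x ∈ Ω, u x = φ x * w x) ∧
      ContinuousOn (fun x => LL p (w x • gradient φ x) (φ x • gradient w x)) S ∧
      Qp p Ω V u = ∫ x in S, LL p (w x • gradient φ x) (φ x • gradient w x) := by
  have hp0 : 0 < p := by linarith
  obtain ⟨hφ1, hφ0, -⟩ := id hgs
  have hu1 : ContDiff ℝ 1 u := hu.c1c.1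
  have hinv : ContDiffOn ℝ 1 (fun x => (φ x)⁻¹) Ω := hφ1.inv fun x hx => (hφ0 x hx).ne'
  have hpw : ContDiffOn ℝ 1 (fun x => φ x ^ (1 - p)) Ω :=
    hφ1.rpow_const_of_ne fun x hx => (hφ0 x hx).ne'
  have hw := C1c_mul ho hu.c1c hinv
  have hη : C1c Ω (fun x => |u x| ^ p) := by
    have hs : tsupport (fun x => |u x| ^ p) ⊆ tsupport u := by
      refine closure_mono fun x hx h0 => hx ?_
      show |u x| ^ p = 0
      rw [h0, abs_zero, Real.zero_rpow hp0.ne']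
    refine ⟨?_, IsCompact.of_isClosed_subset hu.2.1 (isClosed_tsupport _) hs, hs.trans hu.2.2⟩
    exact (contDiff_norm_rpow (E := ℝ) hp).comp hu1
  have hh := C1c_mul ho hη hpw
  have hhS : tsupport (fun x => |u x| ^ p * φ x ^ (1 - p)) ⊆ S := by
    have hss : Function.support (fun x => |u x| ^ p * φ x ^ (1 - p)) ⊆ Function.support u := by
      refine fun x hx h0 => hx ?_
      show |u x| ^ p * φ x ^ (1 - p) = 0
      rw [h0, abs_zero, Real.zero_rpow hp0.ne', zero_mul]
    exact (closure_mono hss).trans huS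
  have hwe := weak_eq hp ho hV hnn hgs hS hSΩ hh.1 hhS
  have hgw : ∀ x ∈ Ω, φ x • gradient (fun x => u x * (φ x)⁻¹) x
      = gradient u x - (u x * (φ x)⁻¹) • gradient φ x := fun x hx => by
    have hd : DifferentiableAt ℝ φ x := (hφ1.contDiffAt (ho.mem_nhds hx)).differentiableAt one_ne_zero
    rw [grad_mul (g := fun x => (φ x)⁻¹) (C1.diff hu1 x) (hd.inv (hφ0 x hx).ne'),
      grad_comp (q := fun t => t⁻¹) (hasDerivAt_inv (hφ0 x hx).ne') hd]
    have := (hφ0 x hx).ne'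
    rw [smul_add, smul_smul, smul_smul, smul_smul, mul_inv_cancel₀ this, one_smul, add_comm,
      sub_eq_add_neg, ← neg_smul]
    congr 2
    field_simp
  have hcg : ContinuousOn (gradient φ) S := by
    intro x hx
    have : ContDiffAt ℝ 1 φ x := hφ1.contDiffAt (ho.mem_nhds (hSΩ hx))
    have h2 := (this.fderiv_right (m := 0) (by norm_num)).continuousAt
    exact ((LinearIsometryEquiv.continuous (InnerProductSpace.toDual ℝ (Ed d)).symm).continuousAt.comp
      h2).continuousWithinAt
  have hcLL : ContinuousOn (fun x => LL p ((u x * (φ x)⁻¹) • gradient φ x)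
      (φ x • gradient (fun x => u x * (φ x)⁻¹) x)) S := by
    have q1 := hw.1.continuous.continuousOn (s := S).smul hcg
    have q2 := (hφ1.continuousOn.mono hSΩ).smul (cont_gradient hw.1).continuousOn
    exact LL_contOn hp q1 q2
  refine ⟨fun x => u x * (φ x)⁻¹, hw.1, fun x hx => ?_, hcLL, ?_⟩
  · have := (hφ0 x hx).ne'
    field_simp
  have i1 : IntegrableOn (fun x => ⟪NG p (gradient φ x),
      gradient (fun x => |u x| ^ p * φ x ^ (1 - p)) x⟫) S :=
    (((NG_continuous hp).comp_continuousOn hcg).inner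
      (cont_gradient hh.1).continuousOn).integrableOn_compact hS
  have i2 : IntegrableOn (fun x => V x * (p * φ x ^ (p - 1) * (|u x| ^ p * φ x ^ (1 - p)))) S := by
    refine intV hV hS hSΩ (ContinuousOn.integrableOn_compact hS ?_)
    refine ContinuousOn.mul (continuousOn_const.mul ?_) hh.1.continuous.continuousOn
    exact (hφ1.continuousOn.mono hSΩ).rpow_const fun x hx => Or.inl (hφ0 x (hSΩ hx)).ne'
  rw [Q_eq hp ho huS hSΩ]
  have hsum : (∫ x in S, ((1 / p) * ⟪NG p (gradient φ x),
      gradient (fun x => |u x| ^ p * φ x ^ (1 - p)) x⟫ + (1 / p) *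
      (V x * (p * φ x ^ (p - 1) * (|u x| ^ p * φ x ^ (1 - p)))))) = 0 := by
    rw [integral_add (i1.const_mul _) (i2.const_mul _), integral_const_mul, integral_const_mul,
      ← mul_add, hwe, mul_zero]
  have hint := integral_add (hcLL.integrableOn_compact hS) ((i1.const_mul (1/p)).add (i2.const_mul (1/p)))
  simp only [Pi.add_apply] at hint
  rw [hsum, add_zero] at hint
  rw [← hint]
  refine setIntegral_congr_fun hS.measurableSet fun x hx => ?_
  beta_reduce
  have hxΩ := hSΩ hx
  have hd : DifferentiableAt ℝ φ x := (hφ1.contDiffAt (ho.mem_nhds hxΩ)).differentiableAt one_ne_zero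
  have hpos := hφ0 x hxΩ
  rw [hgw x hxΩ, picone_pt hp (gradient φ x) (gradient u x) hpos (u x),
    grad_mul (f := fun x => |u x| ^ p) (g := fun x => φ x ^ (1 - p)) (C1.diff hη.1 x)
      ((hpw.contDiffAt (ho.mem_nhds hxΩ)).differentiableAt one_ne_zero),
    grad_comp (q := fun t => t ^ (1 - p)) (Real.hasDerivAt_rpow_const (Or.inl hpos.ne')) hd,
    grad_comp (q := fun t => |t| ^ p) (hasDerivAt_abs_rpow (u x) hp) (C1.diff hu1 x),
    show 1 - p - 1 = -p by ring, div_eq_mul_inv]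
  have : φ x ^ (p - 1) * φ x ^ (1 - p) = 1 := by
    rw [← Real.rpow_add hpos]; norm_num
  have e : 1 / p * (V x * (p * φ x ^ (p - 1) * (|u x| ^ p * φ x ^ (1 - p)))) = V x * |u x| ^ p := by
    calc _ = V x * |u x| ^ p * (φ x ^ (p - 1) * φ x ^ (1 - p)) := by field_simp
      _ = _ := by rw [this, mul_one]
  rw [e]; ring
end Part9

section Part10
variable {d : ℕ}

lemma contOn_grad {φ : Ed d → ℝ} {Ω S : Set (Ed d)} (ho : IsOpen Ω) (hφ1 : ContDiffOn ℝ 1 φ Ω)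
    (hSΩ : S ⊆ Ω) : ContinuousOn (gradient φ) S := by
  intro x hx
  have : ContDiffAt ℝ 1 φ x := hφ1.contDiffAt (ho.mem_nhds (hSΩ hx))
  have h2 := (this.fderiv_right (m := 0) (by norm_num)).continuousAt
  exact ((LinearIsometryEquiv.continuous (InnerProductSpace.toDual ℝ (Ed d)).symm).continuousAt.comp
    h2).continuousWithinAt

set_option maxHeartbeats 1000000 in
lemma goalA {p : ℝ} (hp : 1 < p) {Ω : Set (Ed d)} {V φ : Ed d → ℝ} (ho : IsOpen Ω)
    (hcn : IsConnected Ω)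
    (hV : LocBddOn Ω V) (hnn : NonnegOn p Ω V) (hgs : IsGroundStateOn p Ω V φ)
    {ψ : Ed d → ℝ} (hψ : IsTestOn Ω ψ) (hne : (∫ x in Ω, ψ x * φ x) ≠ 0)
    {K : Set (Ed d)} (hK : IsCompact K) (hKΩ : K ⊆ Ω) :
    ∃ C : ℝ, 0 ≤ C ∧ ∀ u, IsTestOn Ω u →
      ∫ x in K, |u x| ^ p ≤ C * (Qp p Ω V u + |∫ x in Ω, ψ x * u x| ^ p) := by
  have hp0 : 0 < p := by linarith
  obtain ⟨hφ1, hφ0, -⟩ := id hgs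
  obtain ⟨D, hD, hKD', hDΩ, hP⟩ := poin_exhaust hp ho hcn (hK.union hψ.2.1)
    (Set.union_subset hKΩ hψ.2.2)
  have hKD : K ⊆ D := Set.subset_union_left.trans hKD'
  have hψD : tsupport ψ ⊆ D := Set.subset_union_right.trans hKD'
  have hDm := hD.measurableSet
  have hcφ : ContinuousOn φ D := hφ1.continuousOn.mono hDΩ
  have hψΩ : ∀ f : Ed d → ℝ, ∫ x in Ω, ψ x * f x = ∫ x in D, ψ x * f x := fun f =>
    setIntegral_eq_of_subset_of_forall_sdiff_eq_zero ho.measurableSet hDΩ fun x hx => by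
      rw [zero_out (fun h => hx.2 (hψD h)), zero_mul]
  rw [hψΩ] at hne
  obtain ⟨CP, hCP, hpw⟩ := poin_weight hp hD hP (ρ := fun x => ψ x * φ x)
    (hψ.1.continuous.continuousOn.mul hcφ) hne
  obtain ⟨m0, hm0, hm⟩ := hD.exists_forall_le' hcφ (a := 0) (fun x hx => hφ0 x (hDΩ hx))
  obtain ⟨M0, hM0⟩ := hD.exists_bound_of_continuousOn hcφ
  have hcg := contOn_grad ho hφ1 hDΩ
  obtain ⟨M1', hM1'⟩ := hD.exists_bound_of_continuousOn hcg
  obtain ⟨M1, hM1p, hM1⟩ : ∃ M1 : ℝ, 0 ≤ M1 ∧ ∀ x ∈ D, ‖gradient φ x‖ ≤ M1 :=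
    ⟨max M1' 0, le_max_right _ _, fun x hx => (hM1' x hx).trans (le_max_left _ _)⟩
  have hA : 0 < m0 ^ p := Real.rpow_pos_of_pos hm0 p
  have hB : 0 ≤ M1 ^ p := Real.rpow_nonneg hM1p p
  set B := M1 ^ p with hBd
  set A := m0 ^ p with hAd
  set ε := A / (2 * (B * CP + 1)) with hεd
  have hBC : 0 ≤ B * CP := mul_nonneg hB hCP
  have hε : 0 < ε := by positivity
  have hεle : ε * B * CP ≤ A / 2 := by
    have : ε * (2 * (B * CP + 1)) = A := by rw [hεd]; field_simp
    nlinarith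
  obtain ⟨Cε, hCε, hLL⟩ := LL_bound (d := d) hp hε
  refine ⟨(max M0 0) ^ p * (CP * (2 + 2 * Cε / A)), by positivity, fun u hu => ?_⟩
  have hQ0 : 0 ≤ Qp p Ω V u := hnn u hu
  obtain ⟨w, hw, huw, hcL, hQ⟩ := picone hp ho hV hnn hgs (hD.union hu.2.1)
    (Set.union_subset hDΩ hu.2.2) hu Set.subset_union_right
  have hJ : ∫ x in Ω, ψ x * u x = ∫ x in D, ψ x * φ x * w x := by
    rw [hψΩ]
    exact setIntegral_congr_fun hDm fun x hx => by
      beta_reduce; rw [huw x (hDΩ hx)]; ring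
  have hN := hpw w hw
  rw [← hJ] at hN
  have hJ0 : 0 ≤ |∫ x in Ω, ψ x * u x| ^ p := by positivity
  have hL : ∫ x in D, LL p (w x • gradient φ x) (φ x • gradient w x) ≤ Qp p Ω V u := by
    rw [hQ]
    exact mono_int (fun x => LL_nonneg hp _ _) Set.subset_union_left
      (hcL.integrableOn_compact (hD.union hu.2.1))
  have iL : IntegrableOn (fun x => LL p (w x • gradient φ x) (φ x • gradient w x)) D :=
    (hcL.integrableOn_compact (hD.union hu.2.1)).mono_set Set.subset_union_left
  have iN : IntegrableOn (fun x => |w x| ^ p) D :=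
    (cont_pow hp hw.continuous.continuousOn).integrableOn_compact hD
  have iX : IntegrableOn (fun x => ‖gradient w x‖ ^ p) D :=
    (cont_normgrad hw hp).continuousOn.integrableOn_compact hD
  have hX : A * (∫ x in D, ‖gradient w x‖ ^ p) ≤ ε * B * (∫ x in D, |w x| ^ p)
      + Cε * ∫ x in D, LL p (w x • gradient φ x) (φ x • gradient w x) := by
    rw [← integral_const_mul, ← integral_const_mul, ← integral_const_mul,
      ← integral_add (iN.const_mul _) (iL.const_mul _)]
    refine setIntegral_mono_on (iX.const_mul _) ((iN.const_mul _).add (iL.const_mul _)) hDm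
      fun x hx => ?_
    have h1 := hLL (w x • gradient φ x) (φ x • gradient w x)
    have h2 : A * ‖gradient w x‖ ^ p ≤ ‖φ x • gradient w x‖ ^ p := by
      rw [hAd, ← Real.mul_rpow hm0.le (norm_nonneg _), norm_smul]
      refine Real.rpow_le_rpow (by positivity) ?_ hp0.le
      exact mul_le_mul_of_nonneg_right ((hm x hx).trans (le_abs_self _)) (norm_nonneg _)
    have h3 : ‖w x • gradient φ x‖ ^ p ≤ B * |w x| ^ p := by
      rw [hBd, ← Real.mul_rpow hM1p (abs_nonneg _), norm_smul, Real.norm_eq_abs, mul_comm]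
      refine Real.rpow_le_rpow (by positivity) ?_ hp0.le
      exact mul_le_mul_of_nonneg_right (hM1 x hx) (abs_nonneg _)
    have h4 := mul_le_mul_of_nonneg_left h3 hε.le
    linarith
  have hK1 : ∫ x in K, |u x| ^ p ≤ (max M0 0) ^ p * ∫ x in D, |w x| ^ p := by
    have iu : IntegrableOn (fun x => |u x| ^ p) D :=
      (cont_pow hp hu.1.continuous.continuousOn).integrableOn_compact hD
    refine (mono_int (fun x => by positivity) hKD iu).trans ?_
    rw [← integral_const_mul]
    refine setIntegral_mono_on iu (iN.const_mul _) hDm fun x hx => ?_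
    rw [huw x (hDΩ hx), abs_mul, Real.mul_rpow (abs_nonneg _) (abs_nonneg _)]
    refine mul_le_mul_of_nonneg_right (Real.rpow_le_rpow (abs_nonneg _) ?_ hp0.le) (by positivity)
    exact (hM0 x hx).trans (le_max_left _ _)
  have hX0 : 0 ≤ ∫ x in D, ‖gradient w x‖ ^ p := integral_nonneg fun x => by positivity
  generalize (∫ x in D, ‖gradient w x‖ ^ p) = X at *
  generalize (∫ x in D, |w x| ^ p) = N at *
  generalize (∫ x in D, LL p (w x • gradient φ x) (φ x • gradient w x)) = L at *
  generalize |∫ x in Ω, ψ x * u x| ^ p = J at *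
  generalize Qp p Ω V u = Q at *
  refine hK1.trans ?_
  rw [mul_assoc]
  refine mul_le_mul_of_nonneg_left ?_ (by positivity)
  have s1 : A * X ≤ A / 2 * (X + J) + Cε * Q := by
    have t1 : ε * B * N ≤ ε * B * CP * (X + J) := by
      rw [mul_assoc (ε * B)]; exact mul_le_mul_of_nonneg_left hN (by positivity)
    have t2 := mul_le_mul_of_nonneg_right hεle (add_nonneg hX0 hJ0)
    have t3 := mul_le_mul_of_nonneg_left hL hCε
    linarith
  have s2 : X ≤ J + 2 * Cε / A * Q := by
    have : A * X ≤ A * (J + 2 * Cε / A * Q) := by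
      have : A * (J + 2 * Cε / A * Q) = A * J + 2 * Cε * Q := by field_simp
      rw [this]; nlinarith
    exact le_of_mul_le_mul_left this hA
  have hc : 0 ≤ 2 * Cε / A := by positivity
  generalize 2 * Cε / A = c at *
  refine hN.trans ?_
  rw [mul_assoc]
  refine mul_le_mul_of_nonneg_left ?_ hCP
  nlinarith [mul_nonneg hc hJ0]
end Part10

section Part11
variable {d : ℕ}

lemma exists_W {p : ℝ} (hp : 1 < p) {Ω : Set (Ed d)} (ho : IsOpen Ω) (hne : Ω.Nonempty)
    (R : (Ed d → ℝ) → ℝ) (hR : ∀ u, IsTestOn Ω u → 0 ≤ R u)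
    (hA : ∀ K : Set (Ed d), IsCompact K → K ⊆ Ω → ∃ C : ℝ, 0 ≤ C ∧ ∀ u, IsTestOn Ω u →
      ∫ x in K, |u x| ^ p ≤ C * R u) :
    ∃ W : Ed d → ℝ, Continuous W ∧ (∀ x ∈ Ω, 0 < W x) ∧ ∀ u, IsTestOn Ω u →
      ∫ x in Ω, W x * |u x| ^ p ≤ 2 * R u := by
  have hloc : ∀ x : Ω, ∃ χ : Ed d → ℝ, ∃ C : ℝ, IsTestOn Ω χ ∧ (∀ y, 0 ≤ χ y ∧ χ y ≤ 1) ∧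
      {y | 0 < χ y} ∈ 𝓝 (x : Ed d) ∧ 0 ≤ C ∧ ∀ u, IsTestOn Ω u →
        ∫ x in tsupport χ, |u x| ^ p ≤ C * R u := by
    rintro ⟨x, hx⟩
    obtain ⟨χ, hχ, h01, U, hU, hxU, h1⟩ := cutoff ho (isCompact_singleton (x := x)) (by simpa using hx)
    obtain ⟨C, hC, h⟩ := hA _ hχ.2.1 hχ.2.2
    refine ⟨χ, C, hχ, h01, ?_, hC, h⟩
    filter_upwards [hU.mem_nhds (hxU rfl)] with y hy
    show 0 < χ y
    rw [h1 y hy]; exact one_pos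
  choose χ C hχ h01 hnh hC hin using hloc
  obtain ⟨t, htc, hcov⟩ := TopologicalSpace.countable_cover_nhds (α := Ω)
    (f := fun x => {y : Ω | 0 < χ x y}) (fun x => continuous_subtype_val.continuousAt (hnh x))
  have htne : t.Nonempty := by
    obtain ⟨x, hx⟩ := hne
    have : (⟨x, hx⟩ : Ω) ∈ ⋃ x ∈ t, {y : Ω | 0 < χ x y} := hcov ▸ Set.mem_univ _
    simp only [Set.mem_iUnion] at this
    obtain ⟨i, hi, -⟩ := this
    exact ⟨i, hi⟩
  obtain ⟨e, he⟩ := htc.exists_eq_range htne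
  have hcpos : ∀ j, 0 < (1 / 2 : ℝ) ^ j / (1 + C (e j)) := fun j =>
    div_pos (by positivity) (by linarith [hC (e j)])
  have hcle : ∀ j, (1 / 2 : ℝ) ^ j / (1 + C (e j)) ≤ (1 / 2) ^ j := fun j =>
    div_le_self (by positivity) (by linarith [hC (e j)])
  have hcC : ∀ j, (1 / 2 : ℝ) ^ j / (1 + C (e j)) * C (e j) ≤ (1 / 2) ^ j := fun j => by
    have := hC (e j)
    rw [div_mul_eq_mul_div, div_le_iff₀ (by linarith)]
    exact mul_le_mul_of_nonneg_left (by linarith) (by positivity)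
  set c : ℕ → ℝ := fun j => (1 / 2 : ℝ) ^ j / (1 + C (e j)) with hcd
  have hbd : ∀ j x, ‖c j * χ (e j) x‖ ≤ (1 / 2) ^ j := fun j x => by
    rw [Real.norm_of_nonneg (mul_nonneg (hcpos j).le (h01 _ x).1)]
    exact (mul_le_of_le_one_right (hcpos j).le (h01 _ x).2).trans (hcle j)
  have hsm : ∀ x, Summable fun j => c j * χ (e j) x := fun x =>
    Summable.of_norm_bounded summable_geometric_two fun j => hbd j x
  refine ⟨fun x => ∑' j, c j * χ (e j) x, ?_, fun x hx => ?_, fun u hu => ?_⟩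
  · exact continuous_tsum (fun j => continuous_const.mul (hχ (e j)).1.continuous)
      summable_geometric_two hbd
  · have : (⟨x, hx⟩ : Ω) ∈ ⋃ x ∈ t, {y : Ω | 0 < χ x y} := hcov ▸ Set.mem_univ _
    simp only [Set.mem_iUnion] at this
    obtain ⟨i, hi, hi2⟩ := this
    rw [he] at hi
    obtain ⟨j, rfl⟩ := hi
    exact (hsm x).tsum_pos (fun j => mul_nonneg (hcpos j).le (h01 _ x).1) j (mul_pos (hcpos j) hi2)
  · have hcu : Continuous fun x => |u x| ^ p :=
      hu.1.continuous.abs.rpow_const fun _ => Or.inr (by linarith)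
    have hF0 : ∀ j x, 0 ≤ c j * χ (e j) x * |u x| ^ p := fun j x =>
      mul_nonneg (mul_nonneg (hcpos j).le (h01 _ x).1) (by positivity)
    have hFi : ∀ j, Integrable (fun x => c j * χ (e j) x * |u x| ^ p) (volume.restrict Ω) := by
      intro j
      refine Integrable.integrableOn ?_
      refine Continuous.integrable_of_hasCompactSupport
        ((continuous_const.mul (hχ (e j)).1.continuous).mul hcu) ?_
      exact ((hχ (e j)).2.1.mul_left).mul_right
    have hFb : ∀ j, ∫ x in Ω, c j * χ (e j) x * |u x| ^ p ≤ (1 / 2) ^ j * R u := by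
      intro j
      have e1 : ∫ x in Ω, c j * χ (e j) x * |u x| ^ p
          = ∫ x in tsupport (χ (e j)), c j * χ (e j) x * |u x| ^ p :=
        setIntegral_eq_of_subset_of_forall_sdiff_eq_zero ho.measurableSet (hχ (e j)).2.2
          fun x hx => by rw [zero_out hx.2]; simp
      have hKc : IsCompact (tsupport (χ (e j))) := (hχ (e j)).2.1
      have e2 : ∫ x in tsupport (χ (e j)), c j * χ (e j) x * |u x| ^ p
          ≤ ∫ x in tsupport (χ (e j)), c j * |u x| ^ p := by
        refine setIntegral_mono_on ((hFi j).mono_measure (Measure.restrict_mono (hχ (e j)).2.2 le_rfl))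
          ((continuous_const.mul hcu).continuousOn.integrableOn_compact hKc) hKc.measurableSet
          fun x hx => ?_
        exact mul_le_mul_of_nonneg_right
          (mul_le_of_le_one_right (hcpos j).le (h01 _ x).2) (by positivity)
      rw [e1]
      refine e2.trans ?_
      rw [integral_const_mul]
      calc _ ≤ c j * (C (e j) * R u) := mul_le_mul_of_nonneg_left (hin (e j) u hu) (hcpos j).le
        _ = c j * C (e j) * R u := by ring
        _ ≤ _ := mul_le_mul_of_nonneg_right (hcC j) (hR u hu)
    have hgs : HasSum (fun j : ℕ => (1 / 2 : ℝ) ^ j * R u) (2 * R u) :=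
      hasSum_geometric_two.mul_right _
    have hsum := hasSum_integral_of_summable_integral_norm hFi (by
      refine Summable.of_nonneg_of_le (fun j => integral_nonneg fun x => norm_nonneg _)
        (fun j => ?_) hgs.summable
      simp only [Real.norm_of_nonneg (hF0 j _)]
      exact hFb j)
    have := hasSum_le hFb hsum hgs
    refine le_trans (le_of_eq ?_) this
    refine integral_congr_ae (Eventually.of_forall fun x => ?_)
    exact tsum_mul_right.symm
end Part11

/-- Theorem 13.6(e): if `Q_V ≥ 0` admits a ground state `φ₀`, then there is a
continuous `W > 0` on Ω such that for every `ψ ∈ C_c^∞(Ω)` with `∫_Ω ψ φ₀ ≠ 0`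
there is `C > 0` with the Poincaré-type inequality
`Q_V(u) + C|∫_Ω ψu|^p ≥ C⁻¹ ∫_Ω W|u|^p` for all test functions `u`. -/
theorem stmt14 (d : ℕ) (p : ℝ) (hp : 1 < p) (Ω : Set (Ed d))
    (hopen : IsOpen Ω) (hconn : IsConnected Ω)
    (V : Ed d → ℝ) (hV : LocBddOn Ω V)
    (hnn : NonnegOn p Ω V)
    (φ₀ : Ed d → ℝ) (hgs : IsGroundStateOn p Ω V φ₀) :
    ∃ W : Ed d → ℝ, ContinuousOn W Ω ∧ (∀ x ∈ Ω, 0 < W x) ∧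
      ∀ ψ : Ed d → ℝ, IsTestOn Ω ψ → (∫ x in Ω, ψ x * φ₀ x) ≠ 0 →
        ∃ C : ℝ, 0 < C ∧ ∀ u, IsTestOn Ω u →
          C⁻¹ * (∫ x in Ω, W x * |u x| ^ p) ≤
            Qp p Ω V u + C * |∫ x in Ω, ψ x * u x| ^ p := by
  have hp0 : 0 < p := by linarith
  obtain ⟨hφ1, hφ0, -⟩ := id hgs
  obtain ⟨x0, hx0⟩ := hconn.nonempty
  obtain ⟨ψ₀, hψ₀, h01, U, hU, hxU, h1⟩ := cutoff hopen (isCompact_singleton (x := x0))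
    (by simpa using hx0)
  have hne0 : (∫ x in Ω, ψ₀ x * φ₀ x) ≠ 0 := by
    have hc := C1c_mul hopen hψ₀.c1c hφ1
    rw [setIntegral_eq_integral_of_forall_compl_eq_zero (fun x hx => by
      rw [zero_out (fun h => hx (hψ₀.2.2 h)), zero_mul])]
    refine (hc.1.continuous.integral_pos_of_hasCompactSupport_nonneg_nonzero hc.2.1
      (fun x => ?_) (x := x0) ?_).ne'
    · show 0 ≤ ψ₀ x * φ₀ x
      by_cases hx : x ∈ Ω
      · exact mul_nonneg (h01 x).1 (hφ0 x hx).le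
      · rw [zero_out (fun h => hx (hψ₀.2.2 h)), zero_mul]
    · rw [h1 x0 (hxU rfl), one_mul]; exact (hφ0 x0 hx0).ne'
  obtain ⟨W, hWc, hW0, hW⟩ := exists_W hp hopen hconn.nonempty
    (fun u => Qp p Ω V u + |∫ x in Ω, ψ₀ x * u x| ^ p)
    (fun u hu => add_nonneg (hnn u hu) (by positivity))
    (fun K hK hKΩ => goalA hp hopen hconn hV hnn hgs hψ₀ hne0 hK hKΩ)
  refine ⟨W, hWc.continuousOn, hW0, fun ψ hψ hne => ?_⟩
  have hKc : IsCompact (tsupport ψ₀) := hψ₀.2.1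
  obtain ⟨C1, hC1, hA⟩ := goalA hp hopen hconn hV hnn hgs hψ hne hKc hψ₀.2.2
  set c := volume.real (tsupport ψ₀) ^ (p - 1) with hcd
  have hc0 : 0 ≤ c := by positivity
  have hcC : 0 ≤ c * C1 := by positivity
  refine ⟨2 * (1 + c * C1), by positivity, fun u hu => ?_⟩
  have hJ0 : |∫ x in Ω, ψ₀ x * u x| ^ p ≤ c * ∫ x in tsupport ψ₀, |u x| ^ p := by
    refine le_trans (Real.rpow_le_rpow (abs_nonneg _) ?_ hp0.le)
      (jensen_compact hp hKc hu.1.continuous.continuousOn)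
    rw [setIntegral_eq_of_subset_of_forall_sdiff_eq_zero hopen.measurableSet hψ₀.2.2
      (fun x hx => by rw [zero_out hx.2, zero_mul])]
    refine (abs_integral_le_integral_abs).trans ?_
    refine setIntegral_mono_on
      ((hψ₀.1.continuous.mul hu.1.continuous).abs.continuousOn.integrableOn_compact hKc)
      (hu.1.continuous.abs.continuousOn.integrableOn_compact hKc) hKc.measurableSet fun x _ => ?_
    rw [abs_mul, abs_of_nonneg (h01 x).1]
    exact mul_le_of_le_one_left (abs_nonneg _) (h01 x).2
  have hI := hW u hu
  have hAu := mul_le_mul_of_nonneg_left (hA u hu) hc0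
  have hQ := hnn u hu
  have hJ : 0 ≤ |∫ x in Ω, ψ x * u x| ^ p := by positivity
  beta_reduce at hI
  generalize Qp p Ω V u = Q at *
  generalize |∫ x in Ω, ψ x * u x| ^ p = J at *
  rw [inv_mul_le_iff₀ (by positivity)]
  have : (∫ x in Ω, W x * |u x| ^ p) ≤ 2 * (1 + c * C1) * (Q + J) := by nlinarith
  refine this.trans (mul_le_mul_of_nonneg_left ?_ (by positivity))
  nlinarith [mul_nonneg hcC hJ]
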